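/- arXiv:1805.03297 — 2 statements merged into one kernel-verified Lean document; each statement's English description precedes it below -/
import Mathlib

section
/- Let A = Π_Q(k) with Q = Ã_2 (so n = 3) and let g ≠ id be a graded automorphism of A with g(e_i) = e_i for all i, with g(α_i) = c_iα_i, g(α_i^*) = t_iα_i^*, and write Tr_A(g,t) = p(t)/q(t) with q(t) = (1 − c_1c_2c_3t^3)(1 − t_1t_2t_3t^3) and p(t) = 3 + (c_1+c_2+c_3+t_1+t_2+t_3)t + (c_1c_2 + c_1c_3 + c_2c_3 + t_1t_2 + t_1t_3 + t_2t_3 + 3c_1t_1)t^2 + c_1t_1(c_1+c_2+c_3+t_1+t_2+t_3)t^3 + 3(c_1t_1)^2t^4. Then: if c_1c_2c_3 = 1 then p(1) = (3 + c_1 + c_2 + c_3 + c_1c_2 + c_2c_3 + c_1c_3)(1 + c_1t_1 + (c_1t_1)^2); if t_1t_2t_3 = 1 then p(1) = (3 + t_1 + t_2 + t_3 + t_1t_2 + t_2t_3 + t_1t_3)(1 + c_1t_1 + (c_1t_1)^2); and if Tr_A(g,t) has 1 as a pole of order 2, then the fixed ring A^{⟨g⟩} has infinite global dimension. -/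
open CategoryTheory TensorProduct PowerSeries Matrix

noncomputable section

/-! ### Ext groups, projective dimension, global dimension -/

/-- The `i`-th Ext group of modules over a `k`-algebra `R`,
computed in the abelian category `ModuleCat R`. -/
def extGroup (k : Type) [Field k] (R : Type) [Ring R] [Algebra k R] (i : ℕ)
    (M N : ModuleCat.{0} R) : ModuleCat.{0} k :=
  ((_root_.Ext k (ModuleCat.{0} R) i).obj (Opposite.op M)).obj N

/-- `M` has projective dimension `≤ d`, expressed via vanishing of Ext. -/
def projDimLE (k : Type) [Field k] (R : Type) [Ring R] [Algebra k R]
    (M : ModuleCat.{0} R) (d : ℕ) : Prop :=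
  ∀ (N : ModuleCat.{0} R) (i : ℕ), d < i → Subsingleton (extGroup k R i M N)

/-- The projective dimension of a module, as an element of `ℕ∞` (`⊤` = infinite). -/
def projDim (k : Type) [Field k] (R : Type) [Ring R] [Algebra k R]
    (M : ModuleCat.{0} R) : ℕ∞ :=
  sInf {x : ℕ∞ | ∃ d : ℕ, x = (d : ℕ∞) ∧ projDimLE k R M d}

/-- The global dimension of `R` (computed with left `R`-modules; for right modules
apply this to `Rᵐᵒᵖ`), as an element of `ℕ∞`. -/
def globalDim (k : Type) [Field k] (R : Type) [Ring R] [Algebra k R] : ℕ∞ :=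
  sInf {x : ℕ∞ | ∃ d : ℕ, x = (d : ℕ∞) ∧ ∀ M : ModuleCat.{0} R, projDimLE k R M d}

/-! ### The preprojective algebra of type Ã_{n-1}, via its presentation -/

/-- The defining relations of the preprojective algebra of the extended Dynkin
quiver `Ã_{n-1}` among the vertex idempotents `e i`, the arrows `a i : e i → e (i+1)`
and the reversed arrows `s i : e (i+1) → e i` (indices mod `n`); the relation ideal of
the preprojective algebra is generated by `a i * s i = s (i-1) * a (i-1)`. -/
def PreprojectiveRelations (n : ℕ) [NeZero n] {C : Type} [Ring C]
    (e a s : ZMod n → C) : Prop :=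
  (∀ i j, e i * e j = if i = j then e i else 0) ∧
  (∑ i, e i = 1) ∧
  (∀ i, e i * a i = a i) ∧ (∀ i, a i * e (i + 1) = a i) ∧
  (∀ i, e (i + 1) * s i = s i) ∧ (∀ i, s i * e i = s i) ∧
  (∀ i, a i * s i = s (i - 1) * a (i - 1))

/-- `A`, equipped with its grading `𝒜` and elements `e, a, s`, is the preprojective
algebra `Π_Q(k)` of the extended Dynkin quiver `Q = Ã_{n-1}`: the preprojective
relations hold, the vertices have degree `0` and the arrows degree `1`, `A` is
generated as a `k`-algebra by vertices and arrows, and `A` is universal (initial)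
among `k`-algebras with elements satisfying the preprojective relations.  Together
with generation, universality exhibits `A` as the path algebra `kQ̄` of the double
quiver modulo the ideal generated by the preprojective relations. -/
def IsPreprojectiveAlgebraAn (k : Type) [Field k] (n : ℕ) [NeZero n]
    (A : Type) [Ring A] [Algebra k A] (𝒜 : ℕ → Submodule k A)
    (e a s : ZMod n → A) : Prop :=
  PreprojectiveRelations n e a s ∧
  (∀ i, e i ∈ 𝒜 0) ∧ (∀ i, a i ∈ 𝒜 1) ∧ (∀ i, s i ∈ 𝒜 1) ∧
  (Algebra.adjoin k (Set.range e ∪ Set.range a ∪ Set.range s) = ⊤) ∧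
  (∀ (C : Type) [Ring C] [Algebra k C] (e' a' s' : ZMod n → C),
      PreprojectiveRelations n e' a' s' →
      ∃ f : A →ₐ[k] C, (∀ i, f (e i) = e' i) ∧ (∀ i, f (a i) = a' i) ∧
        (∀ i, f (s i) = s' i))

/-! ### Traces and Hilbert series -/

/-- The trace of a linear endomorphism restricted to a subspace `V`
(junk value `0` if `V` is not invariant). -/
def traceOn (k : Type) [Field k] (B : Type) [Ring B] [Algebra k B]
    (f : B →ₗ[k] B) (V : Submodule k B) : k :=
  @dite _ (∀ x ∈ V, f x ∈ V) (Classical.dec _)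
    (fun h => LinearMap.trace k V (f.restrict h)) (fun _ => 0)

/-- The degree-`s` piece of `x·B`, namely `x·𝒜 s`. -/
def pieceLeftMul (k : Type) [Field k] (B : Type) [Ring B] [Algebra k B]
    (𝒜 : ℕ → Submodule k B) (x : B) (s : ℕ) : Submodule k B :=
  (𝒜 s).map (LinearMap.mulLeft k x)

/-- The degree-`s` piece of `x·B·y`. -/
def pieceBothMul (k : Type) [Field k] (B : Type) [Ring B] [Algebra k B]
    (𝒜 : ℕ → Submodule k B) (x y : B) (s : ℕ) : Submodule k B :=
  ((𝒜 s).map (LinearMap.mulRight k y)).map (LinearMap.mulLeft k x)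

/-- The trace series `Tr_M(g,t) = Σ_s tr(g|_{M_s}) t^s` along a family of subspaces. -/
def traceSeries (k : Type) [Field k] (B : Type) [Ring B] [Algebra k B]
    (g : B ≃ₐ[k] B) (M : ℕ → Submodule k B) : PowerSeries k :=
  PowerSeries.mk fun s => traceOn k B g.toLinearMap (M s)

/-- The Hilbert series `Σ_s dim_k(M_s) t^s` of a family of subspaces. -/
def hilbertSeries (k : Type) [Field k] (B : Type) [Ring B] [Algebra k B]
    (M : ℕ → Submodule k B) : PowerSeries k :=
  PowerSeries.mk fun s => (Module.finrank k (M s) : k)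

/-! ### Fixed rings -/

/-- The fixed subring `B^G` of a group of algebra automorphisms. -/
def fixedSubalgebra (k : Type) [Field k] (B : Type) [Ring B] [Algebra k B]
    (G : Subgroup (B ≃ₐ[k] B)) : Subalgebra k B where
  carrier := {x | ∀ g ∈ G, g x = x}
  mul_mem' := by
    intro a b ha hb g hg
    rw [_root_.map_mul, ha g hg, hb g hg]
  add_mem' := by
    intro a b ha hb g hg
    rw [_root_.map_add, ha g hg, hb g hg]
  algebraMap_mem' := by
    intro c g hg
    exact g.commutes c

theorem mem_fixedSubalgebra (k : Type) [Field k] (B : Type) [Ring B] [Algebra k B]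
    (G : Subgroup (B ≃ₐ[k] B)) (x : B) :
    x ∈ fixedSubalgebra k B G ↔ ∀ g ∈ G, g x = x := Iff.rfl

/-- `B` as a right module over a subalgebra `S`. -/
def rightModuleOverSub (k : Type) [Field k] (B : Type) [Ring B] [Algebra k B]
    (S : Subalgebra k B) : Module (↥S)ᵐᵒᵖ B :=
  Module.compHom B (RingHom.op (S.val.toRingHom))

/-- `B` is projective as a right module over the subalgebra `S`. -/
def IsProjectiveOverSub (k : Type) [Field k] (B : Type) [Ring B] [Algebra k B]
    (S : Subalgebra k B) : Prop :=
  @Module.Projective (↥S)ᵐᵒᵖ _ B _ (rightModuleOverSub k B S)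

/-- The grading induced on a subalgebra by a grading of `B`. -/
def subGrading (k : Type) [Field k] (B : Type) [Ring B] [Algebra k B]
    (𝒜 : ℕ → Submodule k B) (S : Subalgebra k B) (j : ℕ) : Submodule k ↥S :=
  (𝒜 j).comap (S.val.toLinearMap)

namespace PPA

section homological
variable {T : Type} [Ring T]

/-- the periodic complex -/
def perComplex (P : ModuleCat.{0} T) (d : P ⟶ P) (hdd : d ≫ d = 0) :
    ChainComplex (ModuleCat.{0} T) ℕ :=
  ChainComplex.of (fun _ => P) (fun _ => d) (fun _ => hdd)

lemma perComplex_d (P : ModuleCat.{0} T) (d : P ⟶ P) (hdd : d ≫ d = 0) (n : ℕ) :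
    (perComplex P d hdd).d (n+1) n = d :=
  ChainComplex.of_d (fun _ => P) (fun _ => d) n

lemma perComplex_exactAt (P : ModuleCat.{0} T) (d : P ⟶ P) (hdd : d ≫ d = 0)
    (hex : (ShortComplex.mk d d hdd).Exact) (n : ℕ) :
    (perComplex P d hdd).ExactAt (n+1) := by
  rw [HomologicalComplex.exactAt_iff' _ (n + 1 + 1) (n + 1) n (by simp) (by simp)]
  refine ShortComplex.exact_of_iso ?_ hex
  refine ShortComplex.isoMk (Iso.refl _) (Iso.refl _) (Iso.refl _) ?_ ?_
  · change 𝟙 _ ≫ (perComplex P d hdd).d (n+2) (n+1) = d ≫ 𝟙 _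
    rw [perComplex_d]; exact (Category.id_comp d).trans (Category.comp_id d).symm
  · change 𝟙 _ ≫ (perComplex P d hdd).d (n+1) (n) = d ≫ 𝟙 _
    rw [perComplex_d]; exact (Category.id_comp d).trans (Category.comp_id d).symm

def perRes (P : ModuleCat.{0} T) [Projective P] (d : P ⟶ P) (hdd : d ≫ d = 0)
    (hex : (ShortComplex.mk d d hdd).Exact) : ProjectiveResolution (Limits.cokernel d) where
  complex := perComplex P d hdd
  projective n := (inferInstance : Projective P)
  π := (ChainComplex.toSingle₀Equiv _ _).symm ⟨Limits.cokernel.π d, by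
          rw [perComplex_d]; exact Limits.cokernel.condition d⟩
  quasiIso := ⟨fun n => by
    cases n
    · rw [ChainComplex.quasiIsoAt₀_iff, ShortComplex.quasiIso_iff_of_zeros']
      · refine (ShortComplex.exact_and_epi_g_iff_of_iso ?_).2
          ⟨ShortComplex.exact_cokernel d, (inferInstance : Epi (Limits.cokernel.π d))⟩
        refine ShortComplex.isoMk (Iso.refl _) (Iso.refl _) (Iso.refl _) ?_ ?_
        swap
        · exact (Category.id_comp _).trans (Category.comp_id _).symm
        change 𝟙 _ ≫ d = (perComplex P d hdd).d 1 0 ≫ 𝟙 _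
        rw [perComplex_d]; exact (Category.id_comp d).trans (Category.comp_id d).symm
      all_goals rfl
    · rw [quasiIsoAt_iff_exactAt']
      · exact perComplex_exactAt P d hdd hex _
      · apply ChainComplex.exactAt_succ_single_obj⟩

lemma ext_not_subsingleton (k : Type) [Field k] [Algebra k T] (P N : ModuleCat.{0} T)
    [Projective P] (d : P ⟶ P) (hdd : d ≫ d = 0)
    (hex : (ShortComplex.mk d d hdd).Exact)
    (hN : ∀ h : P ⟶ N, d ≫ h = 0) (h0 : P ⟶ N) (h0ne : h0 ≠ 0) (n : ℕ) :
    ¬ Subsingleton (extGroup k T (n+1) (Limits.cokernel d) N) := by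
  intro hs
  have hz : Limits.IsZero (extGroup k T (n+1) (Limits.cokernel d) N) :=
    ModuleCat.isZero_of_subsingleton _
  have hz2 : Limits.IsZero (((perRes P d hdd hex).complex.linearYonedaObj k N).homology (n+1)) :=
    hz.of_iso ((perRes P d hdd hex).isoExt (n+1) N).symm
  rw [← HomologicalComplex.exactAt_iff_isZero_homology,
    HomologicalComplex.exactAt_iff' _ n (n + 1) (n+2) (by simp) (by simp),
    ShortComplex.moduleCat_exact_iff] at hz2
  have key : ∀ m (h : P ⟶ N), 
      ((perRes P d hdd hex).complex.linearYonedaObj k N).d m (m+1) h = (0 : P ⟶ N) := by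
    intro m h
    have : (perComplex P d hdd).d (m+1) m ≫ h = (0 : P ⟶ N) := by
      rw [perComplex_d]; exact hN h
    exact this
  obtain ⟨x, hx⟩ := hz2 h0 (key _ h0)
  exact h0ne (hx.symm.trans (key _ x))

theorem globalDim_top_of_periodic (k : Type) [Field k] [Algebra k T] (P N : ModuleCat.{0} T)
    [Projective P] (d : P ⟶ P) (hdd : d ≫ d = 0)
    (hex : (ShortComplex.mk d d hdd).Exact)
    (hN : ∀ h : P ⟶ N, d ≫ h = 0) (h0 : P ⟶ N) (h0ne : h0 ≠ 0) :
    globalDim k T = ⊤ := by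
  unfold globalDim
  rw [sInf_eq_top]
  rintro x ⟨n, rfl, hn⟩
  exact absurd (hn (Limits.cokernel d) N (n+1) (Nat.lt_succ_self n))
    (ext_not_subsingleton k P N d hdd hex hN h0 h0ne n)

end homological
end PPA

namespace PPA

section poly
variable (k : Type) [Field k]

/-- weights of the two variables -/
def wt : Fin 2 → ZMod 3 := ![1, -1]

/-- isotypic components of `k[x,y]` -/
def D (j : ZMod 3) : Submodule k (MvPolynomial (Fin 2) k) :=
  MvPolynomial.weightedHomogeneousSubmodule k wt j

variable {k}

lemma weight_wt (m : Fin 2 →₀ ℕ) : Finsupp.weight wt m = (m 0 : ZMod 3) - m 1 := by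
  rw [Finsupp.weight_apply, Finsupp.sum_fintype _ _ (by simp)]
  simp [wt]; ring

lemma mem_D {j : ZMod 3} {f : MvPolynomial (Fin 2) k} :
    f ∈ D k j ↔ ∀ m, MvPolynomial.coeff m f ≠ 0 → (m 0 : ZMod 3) - m 1 = j := by
  unfold D
  rw [MvPolynomial.mem_weightedHomogeneousSubmodule]
  constructor
  · intro h m hm; rw [← weight_wt]; exact h hm
  · intro h m hm; rw [weight_wt]; exact h m hm

lemma D_mul {i j : ZMod 3} {f g : MvPolynomial (Fin 2) k} (hf : f ∈ D k i) (hg : g ∈ D k j) :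
    f * g ∈ D k (i + j) := MvPolynomial.IsWeightedHomogeneous.mul hf hg

lemma D_one : (1 : MvPolynomial (Fin 2) k) ∈ D k 0 := MvPolynomial.isWeightedHomogeneous_one k wt

lemma D_X0 : (MvPolynomial.X 0 : MvPolynomial (Fin 2) k) ∈ D k 1 :=
  MvPolynomial.isWeightedHomogeneous_X k wt 0

lemma D_X1 : (MvPolynomial.X 1 : MvPolynomial (Fin 2) k) ∈ D k (-1) :=
  MvPolynomial.isWeightedHomogeneous_X k wt 1

lemma D_pow {i : ZMod 3} {f : MvPolynomial (Fin 2) k} (hf : f ∈ D k i) (n : ℕ) :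
    f ^ n ∈ D k (n • i) := MvPolynomial.IsWeightedHomogeneous.pow hf n

lemma D_mono (p q : ℕ) :
    (MvPolynomial.X 0 ^ p * MvPolynomial.X 1 ^ q : MvPolynomial (Fin 2) k) ∈
      D k ((p : ZMod 3) - q) := by
  have := D_mul (D_pow (D_X0 (k := k)) p) (D_pow (D_X1 (k := k)) q)
  convert this using 2
  simp [sub_eq_add_neg]

lemma D_mono' (p q : ℕ) {j : ZMod 3} (h : (p : ZMod 3) - q = j) :
    (MvPolynomial.X 0 ^ p * MvPolynomial.X 1 ^ q : MvPolynomial (Fin 2) k) ∈ D k j :=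
  h ▸ D_mono p q

lemma monomial_eq_xy (m : Fin 2 →₀ ℕ) (r : k) :
    MvPolynomial.monomial m r = r • (MvPolynomial.X 0 ^ (m 0) * MvPolynomial.X 1 ^ (m 1)) := by
  rw [MvPolynomial.monomial_eq, Finsupp.prod_fintype _ _ (by simp), MvPolynomial.smul_eq_C_mul]
  simp

lemma coeff_xy (p q : ℕ) (m : Fin 2 →₀ ℕ) :
    MvPolynomial.coeff m (MvPolynomial.X 0 ^ p * MvPolynomial.X 1 ^ q : MvPolynomial (Fin 2) k)
      = if p = m 0 ∧ q = m 1 then 1 else 0 := by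
  have h : (MvPolynomial.X 0 ^ p * MvPolynomial.X 1 ^ q : MvPolynomial (Fin 2) k)
    = MvPolynomial.monomial (Finsupp.single 0 p + Finsupp.single 1 q) 1 := by
    rw [monomial_eq_xy]; simp
  rw [h, MvPolynomial.coeff_monomial]
  congr 1
  rw [eq_iff_iff, Finsupp.ext_iff, Fin.forall_fin_two]
  simp

/-- induction principle for `D j`: it is spanned by monomials -/
lemma D_induction {j : ZMod 3} (W : Submodule k (MvPolynomial (Fin 2) k))
    (h : ∀ p q : ℕ, (p : ZMod 3) - q = j →
      (MvPolynomial.X 0 ^ p * MvPolynomial.X 1 ^ q : MvPolynomial (Fin 2) k) ∈ W) :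
    D k j ≤ W := by
  intro f hf
  rw [MvPolynomial.as_sum f]
  refine Submodule.sum_mem _ fun m hm => ?_
  rw [monomial_eq_xy]
  exact W.smul_mem _ (h _ _ (mem_D.1 hf m (MvPolynomial.mem_support_iff.1 hm)))

lemma D_gen (u v : MvPolynomial (Fin 2) k) (j : ZMod 3)
    (h : ∀ p q : ℕ, (p : ZMod 3) - q = j →
      ∃ α ∈ D k 0, ∃ β ∈ D k 0, α * u + β * v =
      (MvPolynomial.X 0 ^ p * MvPolynomial.X 1 ^ q : MvPolynomial (Fin 2) k))
    (f : MvPolynomial (Fin 2) k) (hf : f ∈ D k j) :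
    ∃ α ∈ D k 0, ∃ β ∈ D k 0, α * u + β * v = f := by
  let W : Submodule k (MvPolynomial (Fin 2) k) :=
    { carrier := {f | ∃ α ∈ D k 0, ∃ β ∈ D k 0, α * u + β * v = f}
      add_mem' := by
        rintro _ _ ⟨α, hα, β, hβ, rfl⟩ ⟨α', hα', β', hβ', rfl⟩
        exact ⟨α + α', add_mem hα hα', β + β', add_mem hβ hβ', by ring⟩
      zero_mem' := ⟨0, zero_mem _, 0, zero_mem _, by ring⟩
      smul_mem' := by
        rintro r _ ⟨α, hα, β, hβ, rfl⟩
        exact ⟨r • α, Submodule.smul_mem _ _ hα, r • β, Submodule.smul_mem _ _ hβ, by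
          simp only [smul_add, smul_mul_assoc]⟩ }
  exact D_induction W h hf

lemma D_gen1 (f : MvPolynomial (Fin 2) k) (hf : f ∈ D k 1) :
    ∃ α ∈ D k 0, ∃ β ∈ D k 0, α * MvPolynomial.X 0 + β * MvPolynomial.X 1 ^ 2 = f := by
  refine D_gen _ _ 1 ?_ f hf
  intro p q h
  rcases p with _ | p
  · rcases q with _ | _ | q
    · exact absurd h (by decide)
    · exact absurd h (by decide)
    · refine ⟨0, zero_mem _, _, D_mono' 0 q ?_, by ring⟩
      push_cast at h ⊢
      have h3 : (3 : ZMod 3) = 0 := by decide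
      linear_combination h + h3
  · refine ⟨_, D_mono' p q ?_, 0, zero_mem _, by ring⟩
    push_cast at h ⊢
    linear_combination h

lemma D_gen2 (f : MvPolynomial (Fin 2) k) (hf : f ∈ D k 2) :
    ∃ α ∈ D k 0, ∃ β ∈ D k 0, α * MvPolynomial.X 0 ^ 2 + β * MvPolynomial.X 1 = f := by
  refine D_gen _ _ 2 ?_ f hf
  intro p q h
  have h3 : (3 : ZMod 3) = 0 := by decide
  rcases q with _ | q
  · rcases p with _ | _ | p
    · exact absurd h (by decide)
    · exact absurd h (by decide)
    · refine ⟨_, D_mono' p 0 ?_, 0, zero_mem _, by ring⟩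
      push_cast at h ⊢
      linear_combination h
  · refine ⟨0, zero_mem _, _, D_mono' p q ?_, by ring⟩
    push_cast at h ⊢
    linear_combination h + h3

lemma D_of_mul (p q : ℕ) {i j : ZMod 3} (hij : i = j + ((p : ZMod 3) - q))
    (f : MvPolynomial (Fin 2) k)
    (hf : MvPolynomial.X 0 ^ p * MvPolynomial.X 1 ^ q * f ∈ D k i) : f ∈ D k j := by
  rw [mem_D] at hf ⊢
  intro m hm
  have h : (MvPolynomial.X 0 ^ p * MvPolynomial.X 1 ^ q : MvPolynomial (Fin 2) k)
    = MvPolynomial.monomial (Finsupp.single 0 p + Finsupp.single 1 q) 1 := by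
    rw [monomial_eq_xy]; simp
  have := hf (Finsupp.single 0 p + Finsupp.single 1 q + m) (by
    rw [h, MvPolynomial.coeff_monomial_mul, one_mul]; exact hm)
  simp at this
  linear_combination this + hij

lemma not_dvd : ¬ (MvPolynomial.X 1 : MvPolynomial (Fin 2) k) ∣ MvPolynomial.X 0 := by
  rw [MvPolynomial.X_dvd_X]; simp

lemma ker_aux (p q : ℕ) (α β : MvPolynomial (Fin 2) k)
    (h : α * MvPolynomial.X 0 ^ p + β * MvPolynomial.X 1 ^ q = 0) :
    ∃ f, α = MvPolynomial.X 1 ^ q * f ∧ β = - (MvPolynomial.X 0 ^ p * f) := by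
  have hp : Prime (MvPolynomial.X 1 : MvPolynomial (Fin 2) k) := MvPolynomial.X_prime
  have h1 : (MvPolynomial.X 1 : MvPolynomial (Fin 2) k) ^ q ∣ α * MvPolynomial.X 0 ^ p :=
    ⟨-β, by linear_combination h⟩
  have h2 := hp.pow_dvd_of_dvd_mul_right q (fun hh => not_dvd (k := k) (hp.dvd_of_dvd_pow hh)) h1
  obtain ⟨f, rfl⟩ := h2
  refine ⟨f, rfl, ?_⟩
  have hne : (MvPolynomial.X 1 : MvPolynomial (Fin 2) k) ^ q ≠ 0 := pow_ne_zero _ hp.ne_zero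
  apply mul_left_cancel₀ hne
  linear_combination h

end poly
end PPA

namespace PPA
section periodic

theorem globalDim_top_of_hom (k : Type) [Field k] (T : Type) [Ring T] [Algebra k T]
    (ρ : T →+* MvPolynomial (Fin 2) k)
    (hρ : ∀ f, f ∈ D k 0 ↔ ∃ r, ρ r = f) (ε : T) (hε : ρ ε = 1)
    (hker : ∀ r, ρ r = 0 → r * ε = 0) : globalDim k T = ⊤ := by
  let : Module T (MvPolynomial (Fin 2) k) := Module.compHom _ ρ
  have smul_def : ∀ (r : T) (f : MvPolynomial (Fin 2) k), r • f = ρ r * f := fun _ _ => rfl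
  let : Module T k := Module.compHom _ ((MvPolynomial.constantCoeff).comp ρ)
  have smul_k : ∀ (r : T) (f : k), r • f = MvPolynomial.constantCoeff (ρ r) * f := fun _ _ => rfl
  let ρL : T →ₗ[T] MvPolynomial (Fin 2) k :=
    { toFun := ρ
      map_add' := ρ.map_add
      map_smul' := fun r s => by simp [smul_def] }
  let S : Submodule T (MvPolynomial (Fin 2) k) := LinearMap.range ρL
  have hS : ∀ f, f ∈ S ↔ f ∈ D k 0 := fun f => by rw [hρ]; exact LinearMap.mem_range
  -- projectivity
  have hproj : Module.Projective T S := by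
    let m : T →ₗ[T] T := LinearMap.toSpanSingleton T T ε
    have hle : LinearMap.ker ρL ≤ LinearMap.ker m := fun r hr => hker r hr
    let σ : S →ₗ[T] T := ((LinearMap.ker ρL).liftQ m hle) ∘ₗ ρL.quotKerEquivRange.symm.toLinearMap
    refine Module.Projective.of_split σ ρL.rangeRestrict ?_
    ext ⟨_, r, rfl⟩ : 1
    have h1 : σ ⟨ρL r, r, rfl⟩ = r * ε := by
      have : ρL.quotKerEquivRange.symm ⟨ρL r, r, rfl⟩ = (LinearMap.ker ρL).mkQ r := by
        rw [LinearEquiv.symm_apply_eq]; rfl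
      change ((LinearMap.ker ρL).liftQ m hle) (ρL.quotKerEquivRange.symm ⟨ρL r, r, rfl⟩) = _
      rw [this]; rfl
    apply Subtype.ext
    change ρ (σ ⟨ρL r, r, rfl⟩) = ρ r
    rw [h1, map_mul, hε, mul_one]
  -- multiplication operators
  let mul : D k 0 → (S →ₗ[T] S) := fun s =>
    { toFun := fun f => ⟨s.1 * f.1, (hS _).2 (by simpa using D_mul s.2 ((hS _).1 f.2))⟩
      map_add' := fun f g => Subtype.ext (mul_add _ _ _)
      map_smul' := fun r f => Subtype.ext (by
        change s.1 * (ρ r * f.1) = ρ r * (s.1 * f.1); ring) }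
  have mul_def : ∀ s f, (mul s f).1 = s.1 * f.1 := fun _ _ => rfl
  let x : MvPolynomial (Fin 2) k := MvPolynomial.X 0
  let y : MvPolynomial (Fin 2) k := MvPolynomial.X 1
  let mo : (p q : ℕ) → ((p : ZMod 3) - q = 0) → D k 0 := fun p q h => ⟨x ^ p * y ^ q, D_mono' p q h⟩
  let A22 := mul (mo 2 2 (by decide))
  let A11 := mul (mo 1 1 (by decide))
  let A30 := mul (mo 3 0 (by decide))
  let A03 := mul (mo 0 3 (by decide))
  let pr : (i : Fin 4) → ((Fin 4 → S) →ₗ[T] S) := fun i => LinearMap.proj i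
  let d : (Fin 4 → S) →ₗ[T] (Fin 4 → S) := LinearMap.pi
    ![A22 ∘ₗ pr 2 + A03 ∘ₗ pr 3, -(A30 ∘ₗ pr 2 + A11 ∘ₗ pr 3),
      A11 ∘ₗ pr 0 + A03 ∘ₗ pr 1, -(A30 ∘ₗ pr 0 + A22 ∘ₗ pr 1)]
  have d0 : ∀ f, (d f 0).1 = y ^ 2 * ((f 2).1 * x ^ 2 + (f 3).1 * y) := fun f => by
    change x ^ 2 * y ^ 2 * (f 2).1 + x ^ 0 * y ^ 3 * (f 3).1 = _; ring
  have d1 : ∀ f, (d f 1).1 = - (x * ((f 2).1 * x ^ 2 + (f 3).1 * y)) := fun f => by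
    change -(x ^ 3 * y ^ 0 * (f 2).1 + x ^ 1 * y ^ 1 * (f 3).1) = _; ring
  have d2 : ∀ f, (d f 2).1 = y * ((f 0).1 * x + (f 1).1 * y ^ 2) := fun f => by
    change x ^ 1 * y ^ 1 * (f 0).1 + x ^ 0 * y ^ 3 * (f 1).1 = _; ring
  have d3 : ∀ f, (d f 3).1 = - (x ^ 2 * ((f 0).1 * x + (f 1).1 * y ^ 2)) := fun f => by
    change -(x ^ 3 * y ^ 0 * (f 0).1 + x ^ 2 * y ^ 2 * (f 1).1) = _; ring
  have dd : ∀ f, d (d f) = 0 := by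
    intro f
    funext i
    apply Subtype.ext
    fin_cases i
    · change (d (d f) 0).1 = 0
      rw [d0, d2, d3]; ring
    · change (d (d f) 1).1 = 0
      rw [d1, d2, d3]; ring
    · change (d (d f) 2).1 = 0
      rw [d2, d0, d1]; ring
    · change (d (d f) 3).1 = 0
      rw [d3, d0, d1]; ring
  have hy : y ≠ 0 := MvPolynomial.X_ne_zero 1
  have hx : x ≠ 0 := MvPolynomial.X_ne_zero 0
  have dex : ∀ f, d f = 0 → ∃ g, d g = f := by
    intro f hf
    have e0 : (f 2).1 * x ^ 2 + (f 3).1 * y = 0 := by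
      have := d1 f
      rw [hf] at this
      have h2 : x * ((f 2).1 * x ^ 2 + (f 3).1 * y) = 0 := neg_eq_zero.1 this.symm
      exact (mul_eq_zero.1 h2).resolve_left hx
    have e1 : (f 0).1 * x + (f 1).1 * y ^ 2 = 0 := by
      have := d2 f
      rw [hf] at this
      exact (mul_eq_zero.1 this.symm).resolve_left hy
    obtain ⟨h1, hf2, hf3⟩ := ker_aux 2 1 (f 2).1 (f 3).1 (by rw [pow_one]; exact e0)
    obtain ⟨h2, hf0, hf1⟩ := ker_aux 1 2 (f 0).1 (f 1).1 (by rw [pow_one]; exact e1)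
    have h1D : h1 ∈ D k 1 := by
      refine D_of_mul 0 1 (i := 0) (by decide) h1 ?_
      have := (hS _).1 (f 2).2
      rw [hf2] at this
      simpa using this
    have h2D : h2 ∈ D k 2 := by
      refine D_of_mul 0 2 (i := 0) (by decide) h2 ?_
      have := (hS _).1 (f 0).2
      rw [hf0] at this
      simpa using this
    obtain ⟨α, hα, β, hβ, hαβ⟩ := D_gen1 h1 h1D
    obtain ⟨γ, hγ, δ, hδ, hγδ⟩ := D_gen2 h2 h2D
    let G : Fin 4 → S := ![⟨α, (hS _).2 hα⟩, ⟨β, (hS _).2 hβ⟩, ⟨γ, (hS _).2 hγ⟩, ⟨δ, (hS _).2 hδ⟩]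
    have G01 : (G 0).1 * x + (G 1).1 * y ^ 2 = h1 := hαβ
    have G23 : (G 2).1 * x ^ 2 + (G 3).1 * y = h2 := hγδ
    refine ⟨G, ?_⟩
    funext i
    apply Subtype.ext
    fin_cases i
    · change (d G 0).1 = (f 0).1
      rw [d0, G23, hf0]
    · change (d G 1).1 = (f 1).1
      rw [d1, G23, hf1, pow_one]
    · change (d G 2).1 = (f 2).1
      rw [d2, G01, hf2, pow_one]
    · change (d G 3).1 = (f 3).1
      rw [d3, G01, hf3]
  -- homomorphisms to the simple module
  have hsmall : ∀ (h : (Fin 4 → S) →ₗ[T] k) (p q : ℕ) (hpq : (p : ZMod 3) - q = 0)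
      (h0 : 0 < p + q) (f : Fin 4 → S), h (fun i => mul (mo p q hpq) (f i)) = 0 := by
    intro h p q hpq h0 f
    obtain ⟨r, hr⟩ := (hρ _).1 (mo p q hpq).2
    have : (fun i => mul (mo p q hpq) (f i)) = r • f := by
      funext i
      apply Subtype.ext
      change (x ^ p * y ^ q) * (f i).1 = ρ r * (f i).1
      rw [hr]
    rw [this, map_smul, smul_k, hr]
    change MvPolynomial.constantCoeff (x ^ p * y ^ q) * _ = 0
    have : p ≠ 0 ∨ q ≠ 0 := by omega
    rcases this with h | h <;> simp [x, y, h]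
  have hN : ∀ (h : (Fin 4 → S) →ₗ[T] k) f, h (d f) = 0 := by
    intro h f
    have : d f = (fun i => A22 ((![f 2, 0, 0, - f 1] : Fin 4 → S) i))
        + (fun i => A03 ((![f 3, 0, f 1, 0] : Fin 4 → S) i))
        + (fun i => A30 ((![0, - f 2, 0, - f 0] : Fin 4 → S) i))
        + (fun i => A11 ((![0, - f 3, f 0, 0] : Fin 4 → S) i)) := by
      funext i
      fin_cases i
      · change A22 (f 2) + A03 (f 3) = A22 (f 2) + A03 (f 3) + A30 0 + A11 0
        simp
      · change -(A30 (f 2) + A11 (f 3)) = A22 0 + A03 0 + A30 (- f 2) + A11 (- f 3)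
        simp only [map_zero, map_neg]; abel
      · change A11 (f 0) + A03 (f 1) = A22 0 + A03 (f 1) + A30 0 + A11 (f 0)
        simp only [map_zero]; abel
      · change -(A30 (f 0) + A22 (f 1)) = A22 (- f 1) + A03 0 + A30 (- f 0) + A11 0
        simp only [map_zero, map_neg]; abel
    rw [this, map_add, map_add, map_add, hsmall h 2 2 (by decide) (by norm_num), hsmall h 0 3 (by decide) (by norm_num),
      hsmall h 3 0 (by decide) (by norm_num), hsmall h 1 1 (by decide) (by norm_num)]
    simp
  let h0 : (Fin 4 → S) →ₗ[T] k :=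
    { toFun := fun f => MvPolynomial.constantCoeff (f 0).1
      map_add' := fun f g => by
        change MvPolynomial.constantCoeff ((f 0).1 + (g 0).1) = _; rw [map_add]
      map_smul' := fun r f => by
        change MvPolynomial.constantCoeff (ρ r * (f 0).1) = _; rw [map_mul]; rfl }
  have h0ne : h0 (fun _ => ⟨1, (hS _).2 D_one⟩) = 1 := map_one MvPolynomial.constantCoeff
  have : Module.Projective T (Fin 4 → S) :=
    Module.Projective.of_equiv (DFinsupp.linearEquivFunOnFintype (R := T) (M := fun _ : Fin 4 => S))
  have : Projective (ModuleCat.of T (Fin 4 → S)) :=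
    (IsProjective.iff_projective (Fin 4 → S)).1 this
  have hdd' : ModuleCat.ofHom d ≫ ModuleCat.ofHom d = 0 := by
    apply ModuleCat.hom_ext
    exact LinearMap.ext dd
  refine globalDim_top_of_periodic k (ModuleCat.of T (Fin 4 → S)) (ModuleCat.of T k)
    (ModuleCat.ofHom d) hdd' ?_ ?_ (ModuleCat.ofHom h0) ?_
  · rw [ShortComplex.moduleCat_exact_iff]
    exact dex
  · intro h
    apply ModuleCat.hom_ext
    exact LinearMap.ext (hN h.hom)
  · intro hh
    have : h0 = 0 := by
      have := congrArg ModuleCat.Hom.hom hh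
      exact this
    rw [this] at h0ne
    exact zero_ne_one h0ne

end periodic
end PPA

namespace PPA
section alg
variable {A : Type} [Ring A] {e a s : ZMod 3 → A}

/-- basis monomials `e_i x^p y^q` -/
def bb (e a s : ZMod 3 → A) (i : ZMod 3) (p q : ℕ) : A :=
  e i * (∑ j, a j) ^ p * (∑ j, s j) ^ q

variable (h : PreprojectiveRelations 3 e a s)
include h

lemma e_mul_a (i j : ZMod 3) : e i * a j = if i = j then a j else 0 := by
  rw [← h.2.2.1 j, ← mul_assoc, h.1]
  split_ifs with hh
  · rw [hh]
  · rw [zero_mul]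

lemma a_mul_e (i j : ZMod 3) : a i * e j = if j = i + 1 then a i else 0 := by
  rw [← h.2.2.2.1 i, mul_assoc, h.1]
  split_ifs with h1 h2 h2
  · rfl
  · exact absurd h1.symm h2
  · exact absurd h2.symm h1
  · rw [mul_zero]

lemma e_mul_s (i j : ZMod 3) : e i * s j = if i = j + 1 then s j else 0 := by
  rw [← h.2.2.2.2.1 j, ← mul_assoc, h.1]
  split_ifs with hh
  · rw [hh]
  · rw [zero_mul]

lemma s_mul_e (i j : ZMod 3) : s i * e j = if j = i then s i else 0 := by
  rw [← h.2.2.2.2.2.1 i, mul_assoc, h.1]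
  split_ifs with h1 h2 h2
  · rfl
  · exact absurd h1.symm h2
  · exact absurd h2.symm h1
  · rw [mul_zero]

lemma e_mul_x (i : ZMod 3) : e i * (∑ j, a j) = a i := by
  rw [Finset.mul_sum]; simp [e_mul_a h]

lemma e_mul_y (i : ZMod 3) : e (i + 1) * (∑ j, s j) = s i := by
  rw [Finset.mul_sum]; simp [e_mul_s h]

lemma x_mul_e (i : ZMod 3) : (∑ j, a j) * e (i + 1) = a i := by
  rw [Finset.sum_mul]; simp [a_mul_e h]

lemma y_mul_e (i : ZMod 3) : (∑ j, s j) * e i = s i := by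
  rw [Finset.sum_mul]; simp [s_mul_e h]

lemma xy_comm : (∑ j, a j) * (∑ j, s j) = (∑ j, s j) * (∑ j, a j) := by
  have h1 : ∀ i, a i * (∑ j, s j) = a i * s i := fun i => by
    rw [← h.2.2.2.1 i, mul_assoc, e_mul_y h, mul_assoc, h.2.2.2.2.1]
  have h2 : ∀ i, s i * (∑ j, a j) = s i * a i := fun i => by
    rw [← h.2.2.2.2.2.1 i, mul_assoc, e_mul_x h, mul_assoc, h.2.2.1]
  rw [Finset.sum_mul, Finset.sum_mul]
  simp only [h1, h2]
  rw [← Equiv.sum_comp (Equiv.subRight (1 : ZMod 3)) (fun i => s i * a i)]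
  exact Finset.sum_congr rfl fun i _ => h.2.2.2.2.2.2 i

lemma e_mul_bb (j i : ZMod 3) (p q : ℕ) :
    e j * bb e a s i p q = if j = i then bb e a s i p q else 0 := by
  unfold bb
  rw [← mul_assoc, ← mul_assoc, h.1]
  split_ifs with hh
  · rw [hh]
  · simp

lemma a_mul_bb (j i : ZMod 3) (p q : ℕ) :
    a j * bb e a s i p q = if i = j + 1 then bb e a s j (p+1) q else 0 := by
  unfold bb
  rw [← mul_assoc, ← mul_assoc, a_mul_e h]
  split_ifs with hh
  · rw [← e_mul_x h, pow_succ' _ p, ← mul_assoc]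
  · simp

lemma s_mul_bb (j i : ZMod 3) (p q : ℕ) :
    s j * bb e a s i p q = if i = j then bb e a s (j+1) p (q+1) else 0 := by
  unfold bb
  rw [← mul_assoc, ← mul_assoc, s_mul_e h]
  split_ifs with hh
  · rw [← e_mul_y h, pow_succ' _ q, ← mul_assoc, mul_assoc (e (j+1)), mul_assoc (e (j+1)),
      ← ((show Commute _ _ from (xy_comm h)).pow_left p).eq, mul_assoc, mul_assoc, mul_assoc]
  · simp

lemma bb_succ_p (i : ZMod 3) (p q : ℕ) :
    bb e a s i (p+1) q = a i * bb e a s (i+1) p q := by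
  rw [a_mul_bb h, if_pos rfl]

lemma bb_succ_q (i : ZMod 3) (p q : ℕ) :
    bb e a s i p (q+1) = s (i-1) * bb e a s (i-1) p q := by
  rw [s_mul_bb h, if_pos rfl, sub_add_cancel]

omit h in
lemma bb_zero (i : ZMod 3) : bb e a s i 0 0 = e i := by simp [bb]

lemma bb_span {k : Type} [Field k] [Algebra k A]
    (hadj : Algebra.adjoin k (Set.range e ∪ Set.range a ∪ Set.range s) = ⊤) :
    Submodule.span k (Set.range fun x : ZMod 3 × ℕ × ℕ => bb e a s x.1 x.2.1 x.2.2) = ⊤ := by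
  set W := Submodule.span k (Set.range fun x : ZMod 3 × ℕ × ℕ => bb e a s x.1 x.2.1 x.2.2) with hW
  have hbW : ∀ i p q, bb e a s i p q ∈ W := fun i p q => Submodule.subset_span ⟨(i, p, q), rfl⟩
  have stab : ∀ z : A, (∀ i p q, z * bb e a s i p q ∈ W) → ∀ w ∈ W, z * w ∈ W := by
    intro z hz w hw
    have : W ≤ W.comap (LinearMap.mulLeft k z) := by
      rw [hW, Submodule.span_le]
      rintro _ ⟨x, rfl⟩
      exact hz _ _ _
    exact this hw
  let St : Subalgebra k A :=
    { carrier := {z | ∀ w ∈ W, z * w ∈ W}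
      mul_mem' := fun {z z'} hz hz' w hw => by rw [mul_assoc]; exact hz _ (hz' _ hw)
      add_mem' := fun {z z'} hz hz' w hw => by rw [add_mul]; exact add_mem (hz _ hw) (hz' _ hw)
      algebraMap_mem' := fun r w hw => by
        rw [← Algebra.smul_def]; exact W.smul_mem _ hw }
  have hSt : St = ⊤ := by
    rw [eq_top_iff, ← hadj]
    apply Algebra.adjoin_le
    rintro _ ((⟨j, rfl⟩ | ⟨j, rfl⟩) | ⟨j, rfl⟩)
    · apply stab; intro i p q
      rw [e_mul_bb h]; split_ifs
      · exact hbW _ _ _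
      · exact zero_mem _
    · apply stab; intro i p q
      rw [a_mul_bb h]; split_ifs
      · exact hbW _ _ _
      · exact zero_mem _
    · apply stab; intro i p q
      rw [s_mul_bb h]; split_ifs
      · exact hbW _ _ _
      · exact zero_mem _
  rw [eq_top_iff]
  intro z _
  have hz : z ∈ St := by rw [hSt]; trivial
  have h1 : (1 : A) ∈ W := by
    rw [← h.2.1]
    refine Submodule.sum_mem _ fun i _ => ?_
    rw [← bb_zero (e := e) (a := a) (s := s)]
    exact hbW _ _ _
  simpa using hz 1 h1

end alg

section model
variable (k : Type) [Field k]

abbrev Mat := Matrix (ZMod 3) (ZMod 3) (MvPolynomial (Fin 2) k)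

lemma model_rel : PreprojectiveRelations 3 (C := Mat k)
    (fun i => Matrix.single i i 1) (fun i => Matrix.single i (i+1) (MvPolynomial.X 0))
    (fun i => Matrix.single (i+1) i (MvPolynomial.X 1)) := by
  refine ⟨?_, ?_, ?_, ?_, ?_, ?_, ?_⟩
  · intro i j
    split_ifs with hh
    · subst hh; rw [Matrix.single_mul_single_same, mul_one]
    · rw [Matrix.single_mul_single_of_ne _ _ _ _ hh]
  · exact Matrix.sum_single_one
  · intro i; rw [Matrix.single_mul_single_same, one_mul]
  · intro i; rw [Matrix.single_mul_single_same, mul_one]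
  · intro i; rw [Matrix.single_mul_single_same, one_mul]
  · intro i; rw [Matrix.single_mul_single_same, mul_one]
  · intro i; rw [Matrix.single_mul_single_same]
    have : i - 1 + 1 = i := sub_add_cancel _ _
    dsimp only
    rw [this, Matrix.single_mul_single_same, mul_comm]

variable {k} {A : Type} [Ring A] [Algebra k A] {e a s : ZMod 3 → A}
  (h : PreprojectiveRelations 3 e a s) (Φ : A →ₐ[k] Mat k)
  (he : ∀ i, Φ (e i) = Matrix.single i i 1)
  (ha : ∀ i, Φ (a i) = Matrix.single i (i+1) (MvPolynomial.X 0))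
  (hs : ∀ i, Φ (s i) = Matrix.single (i+1) i (MvPolynomial.X 1))
include h he ha hs

lemma Phi_bb (i : ZMod 3) (p q : ℕ) : Φ (bb e a s i p q) =
    Matrix.single i (i + p - q) (MvPolynomial.X 0 ^ p * MvPolynomial.X 1 ^ q) := by
  induction p generalizing i with
  | zero =>
    induction q generalizing i with
    | zero => simp [bb_zero, he]
    | succ q ih =>
      rw [bb_succ_q h, map_mul, hs, ih, sub_add_cancel, Matrix.single_mul_single_same]
      congr 1
      · push_cast; ring
      · ring
  | succ p ih =>
    rw [bb_succ_p h, map_mul, ha, ih, Matrix.single_mul_single_same]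
    congr 1
    · push_cast; ring
    · ring

lemma bb_linInd : LinearIndependent k
    (fun x : ZMod 3 × ℕ × ℕ => bb e a s x.1 x.2.1 x.2.2) := by
  let L : A →ₗ[k] (ZMod 3 × ℕ × ℕ → k) := 
    LinearMap.pi fun x => (MvPolynomial.lcoeff k (Finsupp.single 0 x.2.1 + Finsupp.single 1 x.2.2)) ∘ₗ
      (∑ j, (Matrix.entryLinearMap k (MvPolynomial (Fin 2) k) x.1 j)) ∘ₗ Φ.toLinearMap
  have hL : ∀ x : ZMod 3 × ℕ × ℕ, L (bb e a s x.1 x.2.1 x.2.2) = Pi.single x 1 := by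
    rintro ⟨i, p, q⟩
    funext ⟨i', p', q'⟩
    simp only [L, LinearMap.pi_apply, LinearMap.comp_apply, AlgHom.toLinearMap_apply,
      Phi_bb h Φ he ha hs, LinearMap.sum_apply, Matrix.entryLinearMap_apply]
    by_cases hi : i = i'
    · subst hi
      rw [Finset.sum_eq_single (i + (p : ZMod 3) - q)]
      · rw [Matrix.single_apply_same, MvPolynomial.lcoeff_apply, coeff_xy, Pi.single_apply]
        simp [eq_comm]
      · intro j _ hj
        rw [Matrix.single_apply_of_ne]
        exact fun hh => hj hh.2.symm
      · simp
    · rw [Finset.sum_eq_zero, map_zero, Pi.single_apply, if_neg]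
      · intro hh; simp at hh; exact hi hh.1.symm
      · intro j _
        rw [Matrix.single_apply_of_ne]
        exact fun hh => hi hh.1
  refine LinearIndependent.of_comp L ?_
  have : (L ∘ fun x : ZMod 3 × ℕ × ℕ => bb e a s x.1 x.2.1 x.2.2) = fun x => Pi.single x 1 :=
    funext hL
  rw [this]
  exact Pi.linearIndependent_single_one _ _

end model
end PPA

namespace PPA
section series
variable {k : Type} [Field k]

/-- auxiliary geometric series -/
def U (γ : k) (r : ℕ) : PowerSeries k := PowerSeries.mk fun p => if p % 3 = r then γ ^ (p / 3) else 0

lemma U_mul (γ : k) (r : ℕ) (hr : r < 3) :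
    (1 - PowerSeries.C γ * PowerSeries.X ^ 3) * U γ r = PowerSeries.X ^ r := by
  ext n
  rw [sub_mul, one_mul, mul_assoc, map_sub, PowerSeries.coeff_C_mul, PowerSeries.coeff_X_pow_mul',
    PowerSeries.coeff_X_pow, U, PowerSeries.coeff_mk, PowerSeries.coeff_mk]
  by_cases h3 : 3 ≤ n
  · obtain ⟨m, rfl⟩ := Nat.exists_eq_add_of_le' h3
    have h1 : (m + 3) % 3 = m % 3 := by omega
    have h2 : (m + 3) / 3 = m / 3 + 1 := by omega
    rw [if_pos h3, Nat.add_sub_cancel, h1, h2, if_neg (show m + 3 ≠ r by omega)]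
    split_ifs <;> ring
  · have h1 : n % 3 = n := by omega
    have h2 : n / 3 = 0 := by omega
    rw [if_neg h3, h1, h2]; simp

lemma F_eq (F : ℕ → ℕ → k) (γ τ : k) (hγ : ∀ p q, F (p+3) q = γ * F p q)
    (hτ : ∀ p q, F p (q+3) = τ * F p q) (p q : ℕ) :
    F p q = γ ^ (p / 3) * τ ^ (q / 3) * F (p % 3) (q % 3) := by
  have h1 : ∀ n r q, F (r + 3 * n) q = γ ^ n * F r q := by
    intro n; induction n with
    | zero => simp
    | succ n ih => intro r q; rw [show r + 3 * (n+1) = r + 3 * n + 3 by ring, hγ, ih]; ring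
  have h2 : ∀ n p r, F p (r + 3 * n) = τ ^ n * F p r := by
    intro n; induction n with
    | zero => simp
    | succ n ih => intro r q; rw [show q + 3 * (n+1) = q + 3 * n + 3 by ring, hτ, ih]; ring
  conv_lhs => rw [← Nat.mod_add_div p 3, ← Nat.mod_add_div q 3]
  rw [h1, h2]; ring

lemma series_eq (F : ℕ → ℕ → k) (γ τ : k) (hγ : ∀ p q, F (p+3) q = γ * F p q)
    (hτ : ∀ p q, F p (q+3) = τ * F p q) :
    (1 - PowerSeries.C γ * PowerSeries.X ^ 3) * (1 - PowerSeries.C τ * PowerSeries.X ^ 3) *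
      PowerSeries.mk (fun n => ∑ pq ∈ Finset.HasAntidiagonal.antidiagonal n, F pq.1 pq.2) =
    ∑ r ∈ Finset.range 3, ∑ s ∈ Finset.range 3, PowerSeries.C (F r s) * PowerSeries.X ^ (r + s) := by
  have hG : PowerSeries.mk (fun n => ∑ pq ∈ Finset.HasAntidiagonal.antidiagonal n, F pq.1 pq.2) =
      ∑ r ∈ Finset.range 3, ∑ s ∈ Finset.range 3, PowerSeries.C (F r s) * (U γ r * U τ s) := by
    ext n
    simp only [map_sum, PowerSeries.coeff_C_mul]
    simp only [PowerSeries.coeff_mul, PowerSeries.coeff_mk, U,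
      Finset.mul_sum]
    have : ∀ r ∈ Finset.range 3, ∑ s ∈ Finset.range 3, ∑ x ∈ Finset.HasAntidiagonal.antidiagonal n,
        F r s * ((if x.1 % 3 = r then γ ^ (x.1 / 3) else 0) *
          if x.2 % 3 = s then τ ^ (x.2 / 3) else 0) = 
       ∑ x ∈ Finset.HasAntidiagonal.antidiagonal n, ∑ s ∈ Finset.range 3, 
        F r s * ((if x.1 % 3 = r then γ ^ (x.1 / 3) else 0) *
          if x.2 % 3 = s then τ ^ (x.2 / 3) else 0) := fun r _ => Finset.sum_comm
    rw [Finset.sum_congr rfl this, Finset.sum_comm]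
    refine Finset.sum_congr rfl fun x _ => ?_
    rw [F_eq F γ τ hγ hτ x.1 x.2]
    rw [Finset.sum_eq_single (x.1 % 3), Finset.sum_eq_single (x.2 % 3)]
    · simp; ring
    · intro s _ hs; rw [if_neg (Ne.symm hs)]; simp
    · intro hh; exact absurd (Finset.mem_range.2 (Nat.mod_lt _ (by norm_num))) hh
    · intro s _ hs; simp [if_neg (Ne.symm hs)]
    · intro hh; exact absurd (Finset.mem_range.2 (Nat.mod_lt _ (by norm_num))) hh
  rw [hG, Finset.mul_sum]
  refine Finset.sum_congr rfl fun r hr => ?_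
  rw [Finset.mul_sum]
  refine Finset.sum_congr rfl fun s hs => ?_
  rw [pow_add, ← U_mul γ r (Finset.mem_range.1 hr), ← U_mul τ s (Finset.mem_range.1 hs)]
  ring

/-- eigenvalues -/
def fw (c t : ZMod 3 → k) : ℕ → ℕ → ZMod 3 → k
  | 0, 0, _ => 1
  | 0, q+1, i => t (i-1) * fw c t 0 q (i-1)
  | p+1, q, i => c i * fw c t p q (i+1)

lemma prod3 (c : ZMod 3 → k) (i : ZMod 3) : c i * c (i+1) * c (i+1+1) = c 1 * c 2 * c 0 := by
  fin_cases i
  · change c 0 * c 1 * c 2 = _; ring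
  · change c 1 * c 2 * c 0 = _; ring
  · change c 2 * c 0 * c 1 = _; ring

lemma fw_p (c t : ZMod 3 → k) (p q : ℕ) (i : ZMod 3) :
    fw c t (p+3) q i = (c 1 * c 2 * c 0) * fw c t p q i := by
  rw [← prod3 c i]
  have : i + 1 + 1 + 1 = i := by revert i; decide
  simp only [fw, this]; ring

lemma fw_q (c t : ZMod 3 → k) (p q : ℕ) (i : ZMod 3) :
    fw c t p (q+3) i = (t 1 * t 2 * t 0) * fw c t p q i := by
  induction p generalizing i with
  | zero =>
    rw [← prod3 t i]
    have h3 : i - 1 - 1 - 1 = i := by revert i; decide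
    have h1 : i - 1 = i + 1 + 1 := by revert i; decide
    have h2 : i - 1 - 1 = i + 1 := by revert i; decide
    simp only [fw, h3]
    rw [h2, h1]; ring
  | succ p ih => simp only [fw, ih]; ring

end series

section trace
variable {k : Type} [Field k] {A : Type} [Ring A] [Algebra k A] {e a s : ZMod 3 → A}

lemma g_bb (h : PreprojectiveRelations 3 e a s) (g : A ≃ₐ[k] A) (c t : ZMod 3 → k)
    (hge : ∀ i, g (e i) = e i) (hga : ∀ i, g (a i) = c i • a i) (hgs : ∀ i, g (s i) = t i • s i)
    (i : ZMod 3) (p q : ℕ) : g (bb e a s i p q) = fw c t p q i • bb e a s i p q := by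
  induction p generalizing i with
  | zero =>
    induction q generalizing i with
    | zero => simp [bb_zero, hge, fw]
    | succ q ih =>
      rw [bb_succ_q h, map_mul, hgs, ih, fw, smul_mul_smul_comm]
  | succ p ih =>
    rw [bb_succ_p h, map_mul, hga, ih, fw, smul_mul_smul_comm]

lemma bb_mem (h : PreprojectiveRelations 3 e a s) (𝒜 : ℕ → Submodule k A) [GradedAlgebra 𝒜]
    (h0 : ∀ i, e i ∈ 𝒜 0) (h1 : ∀ i, a i ∈ 𝒜 1) (h2 : ∀ i, s i ∈ 𝒜 1)
    (i : ZMod 3) (p q : ℕ) : bb e a s i p q ∈ 𝒜 (p + q) := by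
  induction p generalizing i with
  | zero =>
    induction q generalizing i with
    | zero => simpa [bb_zero] using h0 i
    | succ q ih =>
      rw [bb_succ_q h]
      have := SetLike.mul_mem_graded (h2 (i-1)) (ih (i-1))
      convert this using 2; ring
  | succ p ih =>
    rw [bb_succ_p h]
    have := SetLike.mul_mem_graded (h1 i) (ih (i+1))
    convert this using 2; ring

lemma grade_le (h : PreprojectiveRelations 3 e a s) (𝒜 : ℕ → Submodule k A) [GradedAlgebra 𝒜]
    (h0 : ∀ i, e i ∈ 𝒜 0) (h1 : ∀ i, a i ∈ 𝒜 1) (h2 : ∀ i, s i ∈ 𝒜 1)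
    (hadj : Algebra.adjoin k (Set.range e ∪ Set.range a ∪ Set.range s) = ⊤) (n : ℕ) :
    𝒜 n ≤ Submodule.span k (Set.range fun x : ZMod 3 × Finset.HasAntidiagonal.antidiagonal n =>
      bb e a s x.1 x.2.1.1 x.2.1.2) := by
  set W := Submodule.span k (Set.range fun x : ZMod 3 × Finset.HasAntidiagonal.antidiagonal n =>
      bb e a s x.1 x.2.1.1 x.2.1.2) with hW
  have key : (⊤ : Submodule k A) ≤ W.comap (GradedAlgebra.proj 𝒜 n) := by
    rw [← bb_span h hadj, Submodule.span_le]
    rintro _ ⟨⟨i, p, q⟩, rfl⟩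
    change GradedAlgebra.proj 𝒜 n (bb e a s i p q) ∈ W
    rw [GradedAlgebra.proj_apply]
    have hm := bb_mem h 𝒜 h0 h1 h2 i p q
    by_cases hn : p + q = n
    · subst hn
      rw [DirectSum.decompose_of_mem_same 𝒜 hm]
      exact Submodule.subset_span ⟨(i, ⟨(p, q), by simp⟩), rfl⟩
    · rw [DirectSum.decompose_of_mem_ne 𝒜 hm hn]
      exact zero_mem _
  intro z hz
  have := key (Submodule.mem_top (x := z))
  rw [Submodule.mem_comap, GradedAlgebra.proj_apply, DirectSum.decompose_of_mem_same 𝒜 hz] at this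
  exact this

lemma trace_eq (h : PreprojectiveRelations 3 e a s) (𝒜 : ℕ → Submodule k A) [GradedAlgebra 𝒜]
    (h0 : ∀ i, e i ∈ 𝒜 0) (h1 : ∀ i, a i ∈ 𝒜 1) (h2 : ∀ i, s i ∈ 𝒜 1)
    (hadj : Algebra.adjoin k (Set.range e ∪ Set.range a ∪ Set.range s) = ⊤)
    (hli : LinearIndependent k (fun x : ZMod 3 × ℕ × ℕ => bb e a s x.1 x.2.1 x.2.2))
    (g : A ≃ₐ[k] A) (c t : ZMod 3 → k)
    (hgr : ∀ j, ∀ x ∈ 𝒜 j, g x ∈ 𝒜 j)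
    (hge : ∀ i, g (e i) = e i) (hga : ∀ i, g (a i) = c i • a i) (hgs : ∀ i, g (s i) = t i • s i)
    (n : ℕ) : traceOn k A g.toLinearMap (𝒜 n) =
      ∑ pq ∈ Finset.HasAntidiagonal.antidiagonal n, ∑ i, fw c t pq.1 pq.2 i := by
  unfold traceOn
  rw [dif_pos (show ∀ x ∈ 𝒜 n, g.toLinearMap x ∈ 𝒜 n from hgr n)]
  let v : ZMod 3 × Finset.HasAntidiagonal.antidiagonal n → 𝒜 n := fun x => ⟨bb e a s x.1 x.2.1.1 x.2.1.2, by
    have := bb_mem h 𝒜 h0 h1 h2 x.1 x.2.1.1 x.2.1.2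
    rwa [Finset.HasAntidiagonal.mem_antidiagonal.1 x.2.2] at this⟩
  have hvli : LinearIndependent k v := by
    refine LinearIndependent.of_comp (𝒜 n).subtype ?_
    exact hli.comp (fun x : ZMod 3 × Finset.HasAntidiagonal.antidiagonal n => (x.1, x.2.1)) (by
      rintro ⟨i, ⟨p, hp⟩⟩ ⟨j, ⟨q, hq⟩⟩ hh
      simp at hh
      simp [hh.1, hh.2])
  have hvsp : ⊤ ≤ Submodule.span k (Set.range v) := by
    rintro ⟨z, hz⟩ _
    have := grade_le h 𝒜 h0 h1 h2 hadj n hz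
    rw [show (Set.range fun x : ZMod 3 × Finset.HasAntidiagonal.antidiagonal n =>
      bb e a s x.1 x.2.1.1 x.2.1.2) = (𝒜 n).subtype '' (Set.range v) by
        rw [← Set.range_comp]; rfl, ← Submodule.map_span] at this
    obtain ⟨w, hw, hwz⟩ := this
    have : w = ⟨z, hz⟩ := Subtype.ext hwz
    rw [← this]; exact hw
  let b := Module.Basis.mk hvli hvsp
  have hb : ∀ x, b x = v x := fun x => Module.Basis.mk_apply hvli hvsp x
  rw [LinearMap.trace_eq_matrix_trace k b, Matrix.trace]
  have hd : ∀ x : ZMod 3 × Finset.HasAntidiagonal.antidiagonal n,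
      (LinearMap.toMatrix b b (g.toLinearMap.restrict (hgr n))).diag x
        = fw c t x.2.1.1 x.2.1.2 x.1 := by
    intro x
    rw [Matrix.diag_apply, LinearMap.toMatrix_apply]
    have : (g.toLinearMap.restrict (hgr n)) (b x) = fw c t x.2.1.1 x.2.1.2 x.1 • b x := by
      rw [hb]
      exact Subtype.ext (g_bb h g c t hge hga hgs _ _ _)
    rw [this, map_smul, Module.Basis.repr_self]
    simp
  rw [Finset.sum_congr rfl fun x _ => hd x, Fintype.sum_prod_type, Finset.sum_comm]
  exact Finset.sum_coe_sort (Finset.HasAntidiagonal.antidiagonal n) (fun pq => ∑ i, fw c t pq.1 pq.2 i)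

end trace
end PPA

namespace PPA
section pole
variable {k : Type} [Field k] [CharZero k]

lemma pole_lemma (G : PowerSeries k) (P : Polynomial k) (γ τ : k)
    (hG : (1 - PowerSeries.C γ * PowerSeries.X ^ 3) * (1 - PowerSeries.C τ * PowerSeries.X ^ 3) * G
      = (P : PowerSeries k))
    (hno : ¬ ∃ pp qq : Polynomial k, Polynomial.eval 1 qq ≠ 0 ∧
        (qq : PowerSeries k) * (1 - PowerSeries.X) * G = (pp : PowerSeries k)) :
    γ = 1 ∧ τ = 1 ∧ Polynomial.eval 1 P ≠ 0 := by
  have h3 : (3 : k) ≠ 0 := by norm_num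
  by_contra hcon
  apply hno
  by_cases hγ : γ = 1
  · by_cases hτ : τ = 1
    · subst hγ hτ
      have hP : Polynomial.IsRoot P 1 := by
        by_contra hh; exact hcon ⟨rfl, rfl, hh⟩
      obtain ⟨R, rfl⟩ := Polynomial.dvd_iff_isRoot.2 hP
      refine ⟨-R, (1 + Polynomial.X + Polynomial.X ^ 2) ^ 2, ?_, ?_⟩
      · simp; norm_num
      · push_cast at hG ⊢
        have hne : (1 - PowerSeries.X : PowerSeries k) ≠ 0 := by
          intro hh
          have := congrArg (PowerSeries.coeff 0) hh
          simp at this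
        apply mul_left_cancel₀ hne
        simp only [map_one] at hG
        linear_combination hG
    · subst hγ
      refine ⟨P, (1 + Polynomial.X + Polynomial.X ^ 2) * (1 - Polynomial.C τ * Polynomial.X ^ 3),
        ?_, ?_⟩
      · simp
        exact ⟨by norm_num, sub_ne_zero.2 (Ne.symm hτ)⟩
      · rw [← hG]; push_cast; simp only [map_one]; ring
  · by_cases hτ : τ = 1
    · subst hτ
      refine ⟨P, (1 + Polynomial.X + Polynomial.X ^ 2) * (1 - Polynomial.C γ * Polynomial.X ^ 3),
        ?_, ?_⟩
      · simp
        exact ⟨by norm_num, sub_ne_zero.2 (Ne.symm hγ)⟩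
      · rw [← hG]; push_cast; simp only [map_one]; ring
    · refine ⟨(1 - Polynomial.X) * P,
        (1 - Polynomial.C γ * Polynomial.X ^ 3) * (1 - Polynomial.C τ * Polynomial.X ^ 3), ?_, ?_⟩
      · simp
        exact ⟨sub_ne_zero.2 (Ne.symm hγ), sub_ne_zero.2 (Ne.symm hτ)⟩
      · push_cast; rw [← hG]; ring

lemma sum_zmod3 {M : Type*} [AddCommMonoid M] (f : ZMod 3 → M) : ∑ i, f i = f 0 + f 1 + f 2 :=
  Fin.sum_univ_three f

omit [CharZero k] in
lemma p_one_c (c t : ZMod 3 → k) (h1 : c 1 * t 1 = c 0 * t 0) (h2 : c 2 * t 2 = c 1 * t 1)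
    (hc : c 1 * c 2 * c 0 = 1) : 
      3 + (c 1 + c 2 + c 0 + t 1 + t 2 + t 0)
        + (c 1 * c 2 + c 1 * c 0 + c 2 * c 0 + t 1 * t 2 + t 1 * t 0 + t 2 * t 0
            + 3 * (c 1 * t 1))
        + c 1 * t 1 * (c 1 + c 2 + c 0 + t 1 + t 2 + t 0)
        + 3 * (c 1 * t 1) ^ 2
      = (3 + c 1 + c 2 + c 0 + c 1 * c 2 + c 2 * c 0 + c 1 * c 0) *
          (1 + c 1 * t 1 + (c 1 * t 1) ^ 2) := by
  have e1 : t 1 = (c 1 * t 1) * (c 2 * c 0) := by linear_combination -t 1 * hc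
  have e2 : t 2 = (c 1 * t 1) * (c 1 * c 0) := by
    linear_combination -t 2 * hc + c 1 * c 0 * h2
  have e0 : t 0 = (c 1 * t 1) * (c 1 * c 2) := by
    linear_combination -t 0 * hc - c 1 * c 2 * h1
  generalize hl : c 1 * t 1 = l at *
  rw [e1, e2, e0]
  linear_combination l ^ 2 * (c 1 + c 2 + c 0) * hc

omit [CharZero k] in
lemma P_one (c t : ZMod 3 → k) (h1 : c 1 * t 1 = c 0 * t 0) (h2 : c 2 * t 2 = c 1 * t 1) :
    ∑ r ∈ Finset.range 3, ∑ s ∈ Finset.range 3, ∑ i, fw c t r s i =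
      3 + (c 1 + c 2 + c 0 + t 1 + t 2 + t 0)
        + (c 1 * c 2 + c 1 * c 0 + c 2 * c 0 + t 1 * t 2 + t 1 * t 0 + t 2 * t 0
            + 3 * (c 1 * t 1))
        + c 1 * t 1 * (c 1 + c 2 + c 0 + t 1 + t 2 + t 0)
        + 3 * (c 1 * t 1) ^ 2 := by
  have a1 : (0 : ZMod 3) + 1 = 1 := by decide
  have a2 : (1 : ZMod 3) + 1 = 2 := by decide
  have a3 : (2 : ZMod 3) + 1 = 0 := by decide
  have b1 : (0 : ZMod 3) - 1 = 2 := by decide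
  have b2 : (1 : ZMod 3) - 1 = 0 := by decide
  have b3 : (2 : ZMod 3) - 1 = 1 := by decide
  simp only [Finset.sum_range_succ, Finset.sum_range_zero, sum_zmod3, fw, a1, a2, a3, b1, b2, b3]
  linear_combination (-1 - c 2 - t 2 - c 1 * t 1 - c 2 * t 2) * h1 +
    (1 + c 1 + t 1 + 2 * (c 1 * t 1)) * h2
end pole
end PPA

namespace PPA
section fin
variable {k : Type} [Field k] {A : Type} [Ring A] [Algebra k A] {e a s : ZMod 3 → A}

lemma Phi_inj (h : PreprojectiveRelations 3 e a s) (Φ : A →ₐ[k] Mat k)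
    (he : ∀ i, Φ (e i) = Matrix.single i i 1)
    (ha : ∀ i, Φ (a i) = Matrix.single i (i+1) (MvPolynomial.X 0))
    (hs : ∀ i, Φ (s i) = Matrix.single (i+1) i (MvPolynomial.X 1))
    (hadj : Algebra.adjoin k (Set.range e ∪ Set.range a ∪ Set.range s) = ⊤)
    (z : A) (hz : Φ z = 0) : z = 0 := by
  have hm := bb_linInd (model_rel k) (AlgHom.id k (Mat k)) (fun _ => rfl) (fun _ => rfl)
    (fun _ => rfl)
  have hz' : z ∈ Submodule.span k
      (Set.range fun x : ZMod 3 × ℕ × ℕ => bb e a s x.1 x.2.1 x.2.2) := by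
    rw [bb_span h hadj]; trivial
  obtain ⟨l, hl⟩ := Finsupp.mem_span_range_iff_exists_finsupp.1 hz'
  have hl0 : l = 0 := by
    apply linearIndependent_iff.1 hm
    rw [Finsupp.linearCombination_apply, ← hz, ← hl, Finsupp.sum, Finsupp.sum, map_sum]
    refine Finset.sum_congr rfl fun x _ => ?_
    rw [map_smul]
    congr 1
    simp only [bb, map_mul, map_pow, map_sum, he, ha, hs]
  rw [← hl, hl0, Finsupp.sum_zero_index]

lemma fw_w (c t w : ZMod 3 → k) (hw : ∀ i, w (i+1) = w i * c i)
    (hct : ∀ i, c i * t i = 1) (p q : ℕ) (i : ZMod 3) :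
    w i * fw c t p q i = w (i + p - q) := by
  induction p generalizing i with
  | zero =>
    induction q generalizing i with
    | zero => simp [fw]
    | succ q ih =>
      have h1 := ih (i - 1)
      have h2 := hw (i - 1)
      rw [sub_add_cancel] at h2
      have h3 := hct (i - 1)
      have h4 : (i - 1 + ((0:ℕ) : ZMod 3) - (q : ZMod 3)) = i + ((0:ℕ) : ZMod 3) - ((q+1 : ℕ) : ZMod 3) := by
        push_cast; ring
      rw [← h4, ← h1, h2]
      simp only [fw]
      linear_combination w (i-1) * fw c t 0 q (i-1) * h3
  | succ p ih =>
    have h1 := ih (i + 1)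
    have h4 : (i + 1 + (p : ZMod 3) - (q : ZMod 3)) = i + ((p+1:ℕ) : ZMod 3) - (q : ZMod 3) := by
      push_cast; ring
    rw [← h4, ← h1, hw]
    simp only [fw]
    ring

lemma Phi_g (h : PreprojectiveRelations 3 e a s) (Φ : A →ₐ[k] Mat k)
    (he : ∀ i, Φ (e i) = Matrix.single i i 1)
    (ha : ∀ i, Φ (a i) = Matrix.single i (i+1) (MvPolynomial.X 0))
    (hs : ∀ i, Φ (s i) = Matrix.single (i+1) i (MvPolynomial.X 1))
    (hadj : Algebra.adjoin k (Set.range e ∪ Set.range a ∪ Set.range s) = ⊤)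
    (g : A ≃ₐ[k] A) (c t w : ZMod 3 → k)
    (hge : ∀ i, g (e i) = e i) (hga : ∀ i, g (a i) = c i • a i) (hgs : ∀ i, g (s i) = t i • s i)
    (hw : ∀ i, w (i+1) = w i * c i)
    (hct : ∀ i, c i * t i = 1) (z : A) (i j : ZMod 3) :
    w i • Φ (g z) i j = w j • Φ z i j := by
  have hz' : z ∈ Submodule.span k
      (Set.range fun x : ZMod 3 × ℕ × ℕ => bb e a s x.1 x.2.1 x.2.2) := by
    rw [bb_span h hadj]; trivial
  induction hz' using Submodule.span_induction with
  | mem x hx =>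
    obtain ⟨⟨i', p, q⟩, rfl⟩ := hx
    dsimp only
    rw [g_bb h g c t hge hga hgs, map_smul, Phi_bb h Φ he ha hs, Matrix.smul_apply]
    rw [Matrix.single_apply]
    split_ifs with hh
    · obtain ⟨rfl, rfl⟩ := hh
      rw [smul_smul, fw_w c t w hw hct]
    · simp
  | zero => simp
  | add x y _ _ hx hy => simp only [map_add, Matrix.add_apply, smul_add, hx, hy]
  | smul r x _ hx =>
    simp only [map_smul, Matrix.smul_apply]
    rw [smul_comm, hx, smul_comm]

lemma Phi_D (h : PreprojectiveRelations 3 e a s) (Φ : A →ₐ[k] Mat k)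
    (he : ∀ i, Φ (e i) = Matrix.single i i 1)
    (ha : ∀ i, Φ (a i) = Matrix.single i (i+1) (MvPolynomial.X 0))
    (hs : ∀ i, Φ (s i) = Matrix.single (i+1) i (MvPolynomial.X 1))
    (hadj : Algebra.adjoin k (Set.range e ∪ Set.range a ∪ Set.range s) = ⊤)
    (z : A) (i : ZMod 3) : Φ z i i ∈ D k 0 := by
  have hz' : z ∈ Submodule.span k
      (Set.range fun x : ZMod 3 × ℕ × ℕ => bb e a s x.1 x.2.1 x.2.2) := by
    rw [bb_span h hadj]; trivial
  induction hz' using Submodule.span_induction with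
  | mem x hx =>
    obtain ⟨⟨i', p, q⟩, rfl⟩ := hx
    dsimp only
    rw [Phi_bb h Φ he ha hs]
    rw [Matrix.single_apply]
    split_ifs with hh
    · obtain ⟨rfl, hh⟩ := hh
      exact D_mono' p q (by linear_combination hh)
    · exact zero_mem _
  | zero => simp
  | add x y _ _ hx hy => simp only [map_add, Matrix.add_apply]; exact add_mem hx hy
  | smul r x _ hx =>
    simp only [map_smul, Matrix.smul_apply]
    exact Submodule.smul_mem _ _ hx

lemma good_case (h : PreprojectiveRelations 3 e a s) (Φ : A →ₐ[k] Mat k)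
    (he : ∀ i, Φ (e i) = Matrix.single i i 1)
    (ha : ∀ i, Φ (a i) = Matrix.single i (i+1) (MvPolynomial.X 0))
    (hs : ∀ i, Φ (s i) = Matrix.single (i+1) i (MvPolynomial.X 1))
    (hadj : Algebra.adjoin k (Set.range e ∪ Set.range a ∪ Set.range s) = ⊤)
    (g : A ≃ₐ[k] A) (c t w : ZMod 3 → k)
    (hge : ∀ i, g (e i) = e i) (hga : ∀ i, g (a i) = c i • a i) (hgs : ∀ i, g (s i) = t i • s i)
    (hw : ∀ i, w (i+1) = w i * c i) (hw0 : ∀ i, w i ≠ 0)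
    (hct : ∀ i, c i * t i = 1) (i0 : ZMod 3) (hi0 : ∀ j, j ≠ i0 → w i0 ≠ w j) :
    globalDim k (↥(fixedSubalgebra k A (Subgroup.zpowers g)))ᵐᵒᵖ = ⊤ := by
  have hoff : ∀ z ∈ fixedSubalgebra k A (Subgroup.zpowers g), ∀ j, j ≠ i0 → Φ z i0 j = 0 := by
    intro z hz j hj
    have h1 := Phi_g h Φ he ha hs hadj g c t w hge hga hgs hw hct z i0 j
    rw [hz g (Subgroup.mem_zpowers g)] at h1
    have h2 : (w i0 - w j) • Φ z i0 j = 0 := by rw [sub_smul, h1, sub_self]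
    exact (smul_eq_zero.1 h2).resolve_left (sub_ne_zero.2 (hi0 j hj))
  have hfix : ∀ z, g z = z → z ∈ fixedSubalgebra k A (Subgroup.zpowers g) := by
    intro z hz g' hg'
    have : Subgroup.zpowers g ≤ MulAction.stabilizer (A ≃ₐ[k] A) z := by
      rw [Subgroup.zpowers_le]; exact hz
    exact this hg'
  have hmul : ∀ x ∈ fixedSubalgebra k A (Subgroup.zpowers g), ∀ y : A,
      ∀ j, Φ (x * y) i0 j = Φ x i0 i0 * Φ y i0 j := by
    intro x hx y j
    rw [map_mul, Matrix.mul_apply]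
    apply Finset.sum_eq_single i0
    · intro j _ hj; rw [hoff x hx j hj, zero_mul]
    · intro hh; exact absurd (Finset.mem_univ _) hh
  let ρ : (↥(fixedSubalgebra k A (Subgroup.zpowers g)))ᵐᵒᵖ →+* MvPolynomial (Fin 2) k :=
    { toFun := fun r => Φ (r.unop : A) i0 i0
      map_one' := by simp
      map_zero' := by simp
      map_add' := fun x y => by simp
      map_mul' := fun x y => by
        change Φ ((y.unop : A) * (x.unop : A)) i0 i0 = _
        rw [hmul _ y.unop.2, mul_comm] }
  refine globalDim_top_of_hom k _ ρ ?_ (MulOpposite.op ⟨e i0, hfix _ (hge i0)⟩) ?_ ?_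
  · intro f
    constructor
    · intro hf
      let W : Submodule k (MvPolynomial (Fin 2) k) :=
        { carrier := {f | ∃ r, ρ r = f}
          zero_mem' := ⟨0, map_zero ρ⟩
          add_mem' := by
            rintro _ _ ⟨x, rfl⟩ ⟨y, rfl⟩; exact ⟨x + y, map_add ρ x y⟩
          smul_mem' := by
            rintro r _ ⟨x, rfl⟩
            refine ⟨r • x, ?_⟩
            change Φ (r • (x.unop : A)) i0 i0 = r • Φ (x.unop : A) i0 i0
            rw [map_smul, Matrix.smul_apply] }
      have : D k 0 ≤ W := by
        apply D_induction
        intro p q hpq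
        have hpq' : i0 + (p : ZMod 3) - q = i0 := by linear_combination hpq
        have hf1 : fw c t p q i0 = 1 := by
          have := fw_w c t w hw hct p q i0
          rw [hpq'] at this
          exact mul_left_cancel₀ (hw0 i0) (by rw [this, mul_one])
        refine ⟨MulOpposite.op ⟨bb e a s i0 p q, hfix _ ?_⟩, ?_⟩
        · rw [g_bb h g c t hge hga hgs, hf1, one_smul]
        · change Φ (bb e a s i0 p q) i0 i0 = _
          rw [Phi_bb h Φ he ha hs, hpq', Matrix.single_apply_same]
      exact this hf
    · rintro ⟨r, rfl⟩
      exact Phi_D h Φ he ha hs hadj _ _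
  · change Φ (e i0) i0 i0 = 1
    rw [he, Matrix.single_apply_same]
  · intro r hr
    apply MulOpposite.unop_injective
    apply Subtype.ext
    change e i0 * (r.unop : A) = 0
    apply Phi_inj h Φ he ha hs hadj
    rw [map_mul, he]
    ext1 i j
    by_cases hi : i = i0
    · subst hi
      rw [Matrix.single_mul_apply_same, one_mul]
      by_cases hj : j = i
      · subst hj; exact hr
      · exact hoff _ r.unop.2 j hj
    · rw [Matrix.single_mul_apply_of_ne _ _ _ _ _ hi]; rfl

lemma lam_rel (h : PreprojectiveRelations 3 e a s)
    (hli : LinearIndependent k (fun x : ZMod 3 × ℕ × ℕ => bb e a s x.1 x.2.1 x.2.2))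
    (g : A ≃ₐ[k] A) (c t : ZMod 3 → k)
    (hga : ∀ i, g (a i) = c i • a i) (hgs : ∀ i, g (s i) = t i • s i)
    (i : ZMod 3) : c i * t i = c (i-1) * t (i-1) := by
  have h1 := congrArg g (h.2.2.2.2.2.2 i)
  rw [map_mul, map_mul, hga, hgs, hga, hgs, smul_mul_smul_comm, smul_mul_smul_comm,
    ← h.2.2.2.2.2.2 i] at h1
  have h2 : a i * s i ≠ 0 := by
    have := hli.ne_zero (i, 1, 1)
    dsimp only at this
    rw [bb_succ_p h, bb_succ_q h, bb_zero] at this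
    rw [add_sub_cancel_right] at this
    rwa [h.2.2.2.2.2.1] at this
  have h3 : (c i * t i - t (i-1) * c (i-1)) • (a i * s i) = 0 := by
    rw [sub_smul, h1, sub_self]
  have := (smul_eq_zero.1 h3).resolve_right h2
  linear_combination this

lemma main_pole [CharZero k] (h : PreprojectiveRelations 3 e a s) (Φ : A →ₐ[k] Mat k)
    (he : ∀ i, Φ (e i) = Matrix.single i i 1)
    (ha : ∀ i, Φ (a i) = Matrix.single i (i+1) (MvPolynomial.X 0))
    (hs : ∀ i, Φ (s i) = Matrix.single (i+1) i (MvPolynomial.X 1))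
    (hadj : Algebra.adjoin k (Set.range e ∪ Set.range a ∪ Set.range s) = ⊤)
    (𝒜 : ℕ → Submodule k A) [GradedAlgebra 𝒜]
    (h0 : ∀ i, e i ∈ 𝒜 0) (h1 : ∀ i, a i ∈ 𝒜 1) (h2 : ∀ i, s i ∈ 𝒜 1)
    (g : A ≃ₐ[k] A) (c t : ZMod 3 → k) (hgr : ∀ j, ∀ x ∈ 𝒜 j, g x ∈ 𝒜 j)
    (hge : ∀ i, g (e i) = e i) (hga : ∀ i, g (a i) = c i • a i) (hgs : ∀ i, g (s i) = t i • s i)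
    (hne : g ≠ AlgEquiv.refl)
    (hno : ¬ ∃ pp qq : Polynomial k, Polynomial.eval 1 qq ≠ 0 ∧
        (qq : PowerSeries k) * (1 - PowerSeries.X) * traceSeries k A g 𝒜
          = (pp : PowerSeries k)) :
    globalDim k (↥(fixedSubalgebra k A (Subgroup.zpowers g)))ᵐᵒᵖ = ⊤ := by
  have hli := bb_linInd h Φ he ha hs
  have hT : traceSeries k A g 𝒜 = PowerSeries.mk (fun n =>
      ∑ pq ∈ Finset.HasAntidiagonal.antidiagonal n, (fun p q => ∑ i, fw c t p q i) pq.1 pq.2) := by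
    unfold traceSeries
    congr 1
    funext n
    exact trace_eq h 𝒜 h0 h1 h2 hadj hli g c t hgr hge hga hgs n
  have l1 : c 1 * t 1 = c 0 * t 0 := lam_rel h hli g c t hga hgs 1
  have l2 : c 2 * t 2 = c 1 * t 1 := lam_rel h hli g c t hga hgs 2
  have hS := series_eq (fun p q => ∑ i, fw c t p q i) (c 1 * c 2 * c 0) (t 1 * t 2 * t 0)
    (fun p q => by simp only [fw_p, Finset.mul_sum]) (fun p q => by simp only [fw_q, Finset.mul_sum])
  rw [← hT] at hS
  obtain ⟨hγ, hτ, hP⟩ := pole_lemma (traceSeries k A g 𝒜)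
    (∑ r ∈ Finset.range 3, ∑ s ∈ Finset.range 3,
      Polynomial.C (∑ i, fw c t r s i) * Polynomial.X ^ (r + s)) _ _
    (by
      rw [hS]
      simp only [Finset.sum_range_succ, Finset.sum_range_zero]
      push_cast
      rfl) hno
  have hev : Polynomial.eval 1 (∑ r ∈ Finset.range 3, ∑ s ∈ Finset.range 3,
      Polynomial.C (∑ i, fw c t r s i) * Polynomial.X ^ (r + s)) =
      ∑ r ∈ Finset.range 3, ∑ s ∈ Finset.range 3, ∑ i, fw c t r s i := by
    simp only [Polynomial.eval_finsetSum, Polynomial.eval_mul, Polynomial.eval_C,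
      Polynomial.eval_pow, Polynomial.eval_X, one_pow, mul_one]
  rw [hev, P_one c t l1 l2, p_one_c c t l1 l2 hγ] at hP
  have hl3 : (c 1 * t 1 - 1) * (1 + c 1 * t 1 + (c 1 * t 1) ^ 2) = 0 := by
    have : (c 1 * t 1) * (c 2 * t 2) * (c 0 * t 0) = 1 := by
      linear_combination (t 1 * t 2 * t 0) * hγ + hτ
    rw [l2, ← l1] at this
    linear_combination this
  have hl : c 1 * t 1 = 1 :=
    sub_eq_zero.1 ((mul_eq_zero.1 hl3).resolve_right (right_ne_zero_of_mul hP))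
  have hct : ∀ i, c i * t i = 1 := by
    intro i
    fin_cases i
    · exact l1.symm.trans hl
    · exact hl
    · exact l2.trans hl
  have hc0 : ∀ i, c i ≠ 0 := fun i => left_ne_zero_of_mul (by rw [hct i]; exact one_ne_zero)
  obtain ⟨w, w0, w1, w2⟩ : ∃ w : ZMod 3 → k, w 0 = 1 ∧ w 1 = c 0 ∧ w 2 = c 0 * c 1 :=
    ⟨![1, c 0, c 0 * c 1], rfl, rfl, rfl⟩
  have hw : ∀ i, w (i+1) = w i * c i := by
    intro i
    fin_cases i
    · change w 1 = w 0 * c 0; rw [w0, w1, one_mul]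
    · change w 2 = w 1 * c 1; rw [w1, w2]
    · change w 0 = w 2 * c 2; rw [w0, w2]; linear_combination -hγ
  have hw0 : ∀ i, w i ≠ 0 := by
    intro i
    fin_cases i
    · change w 0 ≠ 0; rw [w0]; exact one_ne_zero
    · change w 1 ≠ 0; rw [w1]; exact hc0 0
    · change w 2 ≠ 0; rw [w2]; exact mul_ne_zero (hc0 0) (hc0 1)
  have hnall : ¬ (w 0 = w 1 ∧ w 1 = w 2) := by
    rintro ⟨q1, q2⟩
    apply hne
    have hc : ∀ i, c i = 1 := by
      intro i
      have q3 : ∀ j, w j = 1 := by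
        intro j
        fin_cases j
        · exact w0
        · exact q1.symm.trans w0
        · exact q2.symm.trans (q1.symm.trans w0)
      have := hw i
      rw [q3, q3, one_mul] at this
      exact this.symm
    have ht : ∀ i, t i = 1 := by
      intro i; have := hct i; rwa [hc, one_mul] at this
    have hEq : (g : A →ₐ[k] A) = AlgHom.id k A := by
      apply AlgHom.ext_of_adjoin_eq_top hadj
      rintro _ ((⟨j, rfl⟩ | ⟨j, rfl⟩) | ⟨j, rfl⟩)
      · exact hge j
      · change g (a j) = a j; rw [hga, hc, one_smul]
      · change g (s j) = s j; rw [hgs, ht, one_smul]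
    ext z
    exact DFunLike.congr_fun hEq z
  have hex : ∃ i0, ∀ j, j ≠ i0 → w i0 ≠ w j := by
    by_cases q1 : w 0 = w 1
    · have q2 : w 1 ≠ w 2 := fun q => hnall ⟨q1, q⟩
      refine ⟨2, fun j hj => ?_⟩
      fin_cases j
      · change w 2 ≠ w 0; rw [q1]; exact q2.symm
      · exact q2.symm
      · exact absurd rfl hj
    · by_cases q2 : w 0 = w 2
      · refine ⟨1, fun j hj => ?_⟩
        fin_cases j
        · exact Ne.symm q1
        · exact absurd rfl hj
        · change w 1 ≠ w 2; rw [← q2]; exact Ne.symm q1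
      · refine ⟨0, fun j hj => ?_⟩
        fin_cases j
        · exact absurd rfl hj
        · exact q1
        · exact q2
  obtain ⟨i0, hi0⟩ := hex
  exact good_case h Φ he ha hs hadj g c t w hge hga hgs hw hw0 hct i0 hi0

end fin
end PPA

variable (k : Type) [Field k] [IsAlgClosed k] [CharZero k]
variable (A : Type) [Ring A] [Algebra k A] (𝒜 : ℕ → Submodule k A) [GradedAlgebra 𝒜]
variable (e a astar : ZMod 3 → A)
variable (g : A ≃ₐ[k] A) (c t : ZMod 3 → k)

/-- Let `A = Π_Q(k)` with `Q = Ã₂` (vertices indexed by `ZMod 3`,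
with `α₁ = a 1, α₂ = a 2, α₃ = a 0`, etc.) and `g ≠ id` a graded automorphism fixing
the idempotents, `g(αᵢ) = cᵢαᵢ`, `g(αᵢ*) = tᵢαᵢ*`.  Write `Tr_A(g,t) = p(t)/q(t)` with
the explicit `p, q` of Proposition 3.4.  Then `p(1)` factors as stated when
`c₁c₂c₃ = 1` (resp. `t₁t₂t₃ = 1`), and if `Tr_A(g,t)` has `1` as a pole of order `2`
then the fixed ring `A^⟨g⟩` has infinite global dimension. -/
theorem preprojective_A2_pole_order_two
    (hA : IsPreprojectiveAlgebraAn k 3 A 𝒜 e a astar)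
    (hgr : ∀ j, ∀ x ∈ 𝒜 j, g x ∈ 𝒜 j)
    (hge : ∀ i, g (e i) = e i)
    (hga : ∀ i, g (a i) = c i • a i)
    (hgs : ∀ i, g (astar i) = t i • astar i)
    (hne : g ≠ AlgEquiv.refl) :
    (c 1 * c 2 * c 0 = 1 →
      3 + (c 1 + c 2 + c 0 + t 1 + t 2 + t 0)
        + (c 1 * c 2 + c 1 * c 0 + c 2 * c 0 + t 1 * t 2 + t 1 * t 0 + t 2 * t 0
            + 3 * (c 1 * t 1))
        + c 1 * t 1 * (c 1 + c 2 + c 0 + t 1 + t 2 + t 0)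
        + 3 * (c 1 * t 1) ^ 2
      = (3 + c 1 + c 2 + c 0 + c 1 * c 2 + c 2 * c 0 + c 1 * c 0) *
          (1 + c 1 * t 1 + (c 1 * t 1) ^ 2)) ∧
    (t 1 * t 2 * t 0 = 1 →
      3 + (c 1 + c 2 + c 0 + t 1 + t 2 + t 0)
        + (c 1 * c 2 + c 1 * c 0 + c 2 * c 0 + t 1 * t 2 + t 1 * t 0 + t 2 * t 0
            + 3 * (c 1 * t 1))
        + c 1 * t 1 * (c 1 + c 2 + c 0 + t 1 + t 2 + t 0)
        + 3 * (c 1 * t 1) ^ 2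
      = (3 + t 1 + t 2 + t 0 + t 1 * t 2 + t 2 * t 0 + t 1 * t 0) *
          (1 + c 1 * t 1 + (c 1 * t 1) ^ 2)) ∧
    ((¬ ∃ pp qq : Polynomial k, Polynomial.eval 1 qq ≠ 0 ∧
        (qq : PowerSeries k) * (1 - PowerSeries.X) * traceSeries k A g 𝒜
          = (pp : PowerSeries k)) →
      globalDim k (↥(fixedSubalgebra k A (Subgroup.zpowers g)))ᵐᵒᵖ = ⊤) := by
  obtain ⟨h, h0, h1, h2, hadj, hu⟩ := hA
  obtain ⟨Φ, he, ha, hs⟩ := hu (PPA.Mat k) _ _ _ (PPA.model_rel k)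
  have hli := PPA.bb_linInd h Φ he ha hs
  have l1 : c 1 * t 1 = c 0 * t 0 := PPA.lam_rel h hli g c t hga hgs 1
  have l2 : c 2 * t 2 = c 1 * t 1 := PPA.lam_rel h hli g c t hga hgs 2
  refine ⟨fun hc => PPA.p_one_c c t l1 l2 hc, fun ht => ?_, fun hno => ?_⟩
  · have := PPA.p_one_c t c (by linear_combination l1) (by linear_combination l2) ht
    linear_combination this
  · exact PPA.main_pole h Φ he ha hs hadj 𝒜 h0 h1 h2 g c t hgr hge hga hgs hne hno


end
end

section
/- Let B be a noetherian N-graded algebra with B_0 ≅ k^n of finite global dimension d = gl.dim(B) ≥ 1, with simple right modules S_j = e_jB/(e_jB)_{≥1} and simple left modules S_j^* = Be_j/(Be_j)_{≥1}. Assume pdim_B(S_i) = pdim_B(S_j) and pdim_{B^op}(S_i^*) = pdim_{B^op}(S_j^*) for all i, j. If Ext^i_{B^op}(S_j^*, B) = 0 = Ext^i_B(S_j, B) for all i ≠ d and all j, and dim_k Ext^d_{B^op}(S_j^*, B) < ∞ and dim_k Ext^d_B(S_j, B) < ∞ for all j, then dim_k Ext^d_B(S_j, B) = 1 for every j. -/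
open CategoryTheory TensorProduct PowerSeries Matrix

noncomputable section

/-! ### The basic setting: a noetherian ℕ-graded algebra with degree-0 part `k^n` -/

/-- An idempotent is primitive if it is nonzero and cannot be written as the sum of two
nonzero orthogonal idempotents. -/
def IsPrimitiveIdempotent {B : Type} [Ring B] (x : B) : Prop :=
  x ≠ 0 ∧ ∀ f₁ f₂ : B, IsIdempotentElem f₁ → IsIdempotentElem f₂ → f₁ * f₂ = 0 →
    f₂ * f₁ = 0 → x = f₁ + f₂ → f₁ = 0 ∨ f₂ = 0

/-- The setting: `B` is a noetherian `ℕ`-graded locally finite `k`-algebra whose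
degree-zero piece `B₀ ≅ k^n` is spanned by the primitive pairwise orthogonal
idempotents `e i` (which sum to `1`). -/
structure GradedKnAlgebra (k : Type) [Field k] (B : Type) [Ring B] [Algebra k B]
    (𝒜 : ℕ → Submodule k B) {ι : Type} [Fintype ι] [DecidableEq ι] (e : ι → B) : Prop where
  noetherian : IsNoetherianRing B
  noetherian_op : IsNoetherianRing Bᵐᵒᵖ
  locally_finite : ∀ j, FiniteDimensional k (𝒜 j)
  orth : ∀ i j, e i * e j = if i = j then e i else 0
  sum_eq_one : ∑ i, e i = 1
  mem_deg_zero : ∀ i, e i ∈ 𝒜 0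
  deg_zero_eq : 𝒜 0 = Submodule.span k (Set.range e)
  indep : LinearIndependent k e
  primitive : ∀ i, IsPrimitiveIdempotent (e i)

/-! ### Simple modules attached to idempotents -/

/-- The right ideal `xB`, as a right `B`-module (i.e. `Bᵐᵒᵖ`-module). -/
def idemRight (B : Type) [Ring B] (x : B) : Submodule Bᵐᵒᵖ B :=
  Submodule.span Bᵐᵒᵖ {x}

/-- `(xB)_{≥1}`, as a right `B`-submodule of `B`. -/
def idemRightPos (k : Type) [Field k] (B : Type) [Ring B] [Algebra k B]
    (𝒜 : ℕ → Submodule k B) (x : B) : Submodule Bᵐᵒᵖ B :=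
  Submodule.span Bᵐᵒᵖ {y | ∃ m, 1 ≤ m ∧ ∃ z ∈ 𝒜 m, y = x * z}

/-- The simple right `B`-module `xB/(xB)_{≥1}` attached to an idempotent `x`. -/
abbrev simpleRight (k : Type) [Field k] (B : Type) [Ring B] [Algebra k B]
    (𝒜 : ℕ → Submodule k B) (x : B) :=
  (idemRight B x) ⧸ (Submodule.comap (idemRight B x).subtype (idemRightPos k B 𝒜 x))

/-- The left ideal `Bx`, as a left `B`-module. -/
def idemLeft (B : Type) [Ring B] (x : B) : Submodule B B :=
  Submodule.span B {x}

/-- `(Bx)_{≥1}`, as a left `B`-submodule of `B`. -/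
def idemLeftPos (k : Type) [Field k] (B : Type) [Ring B] [Algebra k B]
    (𝒜 : ℕ → Submodule k B) (x : B) : Submodule B B :=
  Submodule.span B {y | ∃ m, 1 ≤ m ∧ ∃ z ∈ 𝒜 m, y = z * x}

/-- The simple left `B`-module `Bx/(Bx)_{≥1}` attached to an idempotent `x`. -/
abbrev simpleLeft (k : Type) [Field k] (B : Type) [Ring B] [Algebra k B]
    (𝒜 : ℕ → Submodule k B) (x : B) :=
  (idemLeft B x) ⧸ (Submodule.comap (idemLeft B x).subtype (idemLeftPos k B 𝒜 x))

/-- The simple right module as an object of `ModuleCat Bᵐᵒᵖ`. -/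
def simpleRightCat (k : Type) [Field k] (B : Type) [Ring B] [Algebra k B]
    (𝒜 : ℕ → Submodule k B) (x : B) : ModuleCat.{0} Bᵐᵒᵖ :=
  ModuleCat.of Bᵐᵒᵖ (simpleRight k B 𝒜 x)

/-- The simple left module as an object of `ModuleCat B`. -/
def simpleLeftCat (k : Type) [Field k] (B : Type) [Ring B] [Algebra k B]
    (𝒜 : ℕ → Submodule k B) (x : B) : ModuleCat.{0} B :=
  ModuleCat.of B (simpleLeft k B 𝒜 x)

/-- `B` as a right module over itself. -/
def selfRightCat (B : Type) [Ring B] : ModuleCat.{0} Bᵐᵒᵖ := ModuleCat.of Bᵐᵒᵖ B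

/-- `B` as a left module over itself. -/
def selfLeftCat (B : Type) [Ring B] : ModuleCat.{0} B := ModuleCat.of B B


/-! ### Tools on Ext -/

/-- Two surjections with the same kernel have isomorphic targets. -/
theorem equiv_of_surj {k V W U : Type*} [Field k] [AddCommGroup V] [AddCommGroup W]
    [AddCommGroup U] [Module k V] [Module k W] [Module k U] (f : V →ₗ[k] W) (g : V →ₗ[k] U)
    (hf : Function.Surjective f) (hg : Function.Surjective g)
    (h : ∀ v, f v = 0 ↔ g v = 0) : Nonempty (W ≃ₗ[k] U) := by
  have hk : LinearMap.ker f = LinearMap.ker g := by ext v; simp [h]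
  exact ⟨(f.quotKerEquivOfSurjective hf).symm ≪≫ₗ Submodule.quotEquivOfEq _ _ hk ≪≫ₗ
    (g.quotKerEquivOfSurjective hg)⟩

/-- The derived category Ext of modules over a `k`-algebra. -/
abbrev EX (R : Type) [Ring R] (M N : Type) [AddCommGroup M] [Module R M] [AddCommGroup N]
    [Module R N] (i : ℕ) : Type :=
  Abelian.Ext.{0} (ModuleCat.of R M) (ModuleCat.of R N) i


theorem sc_homology_surj {k : Type} [Field k] (S : ShortComplex (ModuleCat.{0} k)) :
    ∃ h : LinearMap.ker S.g.hom →ₗ[k] S.homology, Function.Surjective h ∧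
      ∀ x, h x = 0 ↔ ∃ y, S.f y = x.1 := by
  let ψ : (LinearMap.ker S.g.hom ⧸ LinearMap.range S.moduleCatToCycles) ≃ₗ[k] S.homology :=
    S.moduleCatHomologyIso.toLinearEquiv.symm
  refine ⟨ψ.toLinearMap ∘ₗ Submodule.mkQ _, ?_, ?_⟩
  · exact ψ.surjective.comp (Submodule.mkQ_surjective _)
  · intro x
    simp only [LinearMap.comp_apply, LinearEquiv.coe_coe, LinearEquiv.map_eq_zero_iff]
    rw [Submodule.mkQ_apply, Submodule.Quotient.mk_eq_zero]
    constructor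
    · rintro ⟨y, hy⟩
      exact ⟨y, congrArg Subtype.val hy⟩
    · rintro ⟨y, hy⟩
      exact ⟨y, Subtype.ext hy⟩

theorem complex_homology_surj {k : Type} [Field k] {R : Type} [Ring R] [Algebra k R]
    (P : ChainComplex (ModuleCat.{0} R) ℕ) (Y : ModuleCat.{0} R) (a b c : ℕ)
    (ha : (ComplexShape.up ℕ).prev b = a) (hc : (ComplexShape.up ℕ).next b = c) :
    ∃ h : LinearMap.ker (Linear.leftComp k Y (P.d c b)) →ₗ[k]
        (P.linearYonedaObj k Y).homology b, Function.Surjective h ∧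
      ∀ x, h x = 0 ↔ ∃ g : P.X a ⟶ Y, P.d b a ≫ g = x.1 := by
  let K := P.linearYonedaObj k Y
  let e1 : K.homology b ≅ (K.sc' a b c).homology :=
      ShortComplex.homologyMapIso (K.isoSc' a b c ha hc)
  obtain ⟨h, hs, hk⟩ := sc_homology_surj (K.sc' a b c)
  let h' : LinearMap.ker (Linear.leftComp k Y (P.d c b)) →ₗ[k] (K.sc' a b c).homology := h
  refine ⟨e1.toLinearEquiv.symm.toLinearMap ∘ₗ h', ?_, ?_⟩
  · exact e1.toLinearEquiv.symm.surjective.comp hs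
  · intro x
    simp only [LinearMap.comp_apply, LinearEquiv.coe_coe, LinearEquiv.map_eq_zero_iff]
    exact hk x

theorem ext_bridge {k : Type} [Field k] {R : Type} [Ring R] [Algebra k R]
    (X Y : ModuleCat.{0} R) (i : ℕ) :
    Nonempty (extGroup k R i X Y ≃ₗ[k] Abelian.Ext.{0} X Y i) := by
  let P := projectiveResolution X
  suffices h : Nonempty ((P.complex.linearYonedaObj k Y).homology i ≃ₗ[k]
      Abelian.Ext.{0} X Y i) by
    obtain ⟨h⟩ := h
    exact ⟨(P.isoExt i Y).toLinearEquiv ≪≫ₗ h⟩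
  cases i with
  | zero =>
    obtain ⟨h, hs, hk⟩ := complex_homology_surj (k := k) P.complex Y 0 0 1 (by simp) (by simp)
    let π : P.complex.X 0 ⟶ X := P.π.f 0
    have hπ : P.complex.d 1 0 ≫ π = 0 := P.complex_d_comp_π_f_zero
    have hepi : Epi π := inferInstanceAs (Epi (P.π.f 0))
    have hex : (ShortComplex.mk _ _ hπ).Exact := P.exact₀
    let a : (X ⟶ Y) →ₗ[k] LinearMap.ker (Linear.leftComp k Y (P.complex.d 1 0)) :=
      LinearMap.codRestrict _ (Linear.leftComp k Y π) (by
        intro g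
        simp only [LinearMap.mem_ker, Linear.leftComp_apply]
        rw [← Category.assoc, hπ, Limits.zero_comp])
    refine equiv_of_surj (h ∘ₗ a) (Abelian.Ext.linearEquiv₀ (R := k)).symm.toLinearMap
      ?_ (LinearEquiv.surjective _) ?_
    · refine hs.comp ?_
      rintro ⟨f, hf⟩
      have hf' : P.complex.d 1 0 ≫ f = 0 := hf
      exact ⟨hex.desc f hf', Subtype.ext (hex.g_desc f hf')⟩
    · intro g
      simp only [LinearMap.comp_apply, LinearEquiv.coe_coe, LinearEquiv.map_eq_zero_iff, hk]
      constructor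
      · rintro ⟨y, hy⟩
        rw [P.complex.shape 0 0 (by simp), Limits.zero_comp] at hy
        have : π ≫ g = 0 := hy.symm
        rwa [← Limits.comp_zero (f := π), cancel_epi] at this
      · rintro rfl
        exact ⟨0, by simp⟩
  | succ n =>
    obtain ⟨h, hs, hk⟩ := complex_homology_surj (k := k) P.complex Y n (n+1) (n+2)
      (by simp) (by simp)
    have hz : ∀ x : LinearMap.ker (Linear.leftComp k Y (P.complex.d (n+2) (n+1))),
       P.complex.d (n+2) (n+1) ≫ x.1 = 0 := fun x => x.2
    refine equiv_of_surj h
      { toFun := fun x => P.extMk x.1 (n+2) rfl (hz x)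
        map_add' := ?_, map_smul' := ?_ } hs ?_ ?_
    · intro x y
      rw [P.add_extMk]; rfl
    · intro c x
      rw [RingHom.id_apply, Abelian.Ext.smul_eq_comp_mk₀, P.extMk_comp_mk₀]
      congr 1
    · intro α
      obtain ⟨f, hf, rfl⟩ := P.extMk_surjective α (n+2) rfl
      exact ⟨⟨f, hf⟩, rfl⟩
    · intro x
      rw [hk]
      exact (P.extMk_eq_zero_iff x.1 (n+2) rfl (hz x) n rfl).symm



section tools
variable {k : Type} [Field k] {R : Type} [Ring R] [Algebra k R]
variable {K F M N : Type} [AddCommGroup K] [Module R K] [AddCommGroup F] [Module R F]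
  [AddCommGroup M] [Module R M] [AddCommGroup N] [Module R N]

/-- Degree zero Ext, linearly. -/
def homExt (k : Type) [Field k] {R : Type} [Ring R] [Algebra k R]
    (M N : Type) [AddCommGroup M] [Module R M] [AddCommGroup N] [Module R N]
    [Module k N] [IsScalarTower k R N] :
    (M →ₗ[R] N) →ₗ[k] EX R M N 0 where
  toFun f := Abelian.Ext.mk₀ (ModuleCat.ofHom f)
  map_add' f g := by rw [ModuleCat.ofHom_add, Abelian.Ext.mk₀_add]
  map_smul' c f := by
    rw [RingHom.id_apply, ← Abelian.Ext.mk₀_smul]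
    congr 1
    ext x
    change c • f x = algebraMap k R c • f x
    rw [algebraMap_smul]

theorem homExt_bijective [Module k N] [IsScalarTower k R N] :
    Function.Bijective (homExt k (R := R) M N) := by
  constructor
  · intro f g h
    exact congrArg ModuleCat.Hom.hom ((Abelian.Ext.mk₀_bijective _ _).1 h)
  · intro x
    obtain ⟨φ, rfl⟩ := (Abelian.Ext.mk₀_bijective _ _).2 x
    exact ⟨φ.hom, rfl⟩

theorem ext_zero_equiv [Module k N] [IsScalarTower k R N] :
    Nonempty ((M →ₗ[R] N) ≃ₗ[k] EX R M N 0) :=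
  ⟨LinearEquiv.ofBijective (homExt k M N) homExt_bijective⟩

/-- The short complex of modules. -/
abbrev mkSC (f : K →ₗ[R] F) (g : F →ₗ[R] M) (h : Function.Exact f g) :
    ShortComplex (ModuleCat.{0} R) :=
  ShortComplex.mk (ModuleCat.ofHom f) (ModuleCat.ofHom g)
    (by ext x; exact h.apply_apply_eq_zero x)

theorem mkSC_shortExact (f : K →ₗ[R] F) (g : F →ₗ[R] M) (h : Function.Exact f g)
    (hf : Function.Injective f) (hg : Function.Surjective g) : (mkSC f g h).ShortExact :=
  ModuleCat.shortComplex_shortExact _ h hf hg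

theorem ext_proj_subsingleton [Module.Projective R F] (i : ℕ) :
    Subsingleton (EX R F N (i+1)) := by
  have : Projective (ModuleCat.of R F) := ModuleCat.projective_of_categoryTheory_projective _
  exact Abelian.Ext.subsingleton_of_projective _ _ _

theorem ext_one [Module k N] [IsScalarTower k R N] [Module.Projective R F]
    (f : K →ₗ[R] F) (g : F →ₗ[R] M) (h : Function.Exact f g)
    (hf : Function.Injective f) (hg : Function.Surjective g) :
    ∃ δ : (K →ₗ[R] N) →ₗ[k] EX R M N 1, Function.Surjective δ ∧
      ∀ φ, δ φ = 0 ↔ ∃ ψ : F →ₗ[R] N, ψ ∘ₗ f = φ := by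
  have hS := mkSC_shortExact f g h hf hg
  have hF := ext_proj_subsingleton (R := R) (F := F) (N := N) 0
  let δ0 := hS.extClass.precompOfLinear k (ModuleCat.of R N) (show 1 + 0 = 1 from rfl)
  refine ⟨δ0 ∘ₗ homExt k K N, ?_, ?_⟩
  · have h0 : Function.Surjective δ0 := by
      intro x
      obtain ⟨y, hy⟩ := Abelian.Ext.contravariant_sequence_exact₃ hS (ModuleCat.of R N) x
        (Subsingleton.elim (α := EX R F N (0+1)) _ _) (show 1 + 0 = 1 from rfl)
      exact ⟨y, hy⟩
    exact h0.comp homExt_bijective.2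
  · intro φ
    constructor
    · intro hφ
      obtain ⟨y, hy⟩ := Abelian.Ext.contravariant_sequence_exact₁ hS (ModuleCat.of R N) _
        (show 1 + 0 = 1 from rfl) hφ
      obtain ⟨ψ, rfl⟩ := (Abelian.Ext.mk₀_bijective _ _).2 y
      refine ⟨ψ.hom, ?_⟩
      have h2 : Abelian.Ext.mk₀ (ModuleCat.ofHom f ≫ ψ) = Abelian.Ext.mk₀ (ModuleCat.ofHom φ) := by
        rw [← Abelian.Ext.mk₀_comp_mk₀]
        exact hy
      have h3 := (Abelian.Ext.mk₀_bijective _ _).1 h2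
      exact congrArg ModuleCat.Hom.hom h3
    · rintro ⟨ψ, rfl⟩
      change hS.extClass.comp (Abelian.Ext.mk₀ ((mkSC f g h).f ≫ ModuleCat.ofHom ψ))
        (show 1 + 0 = 1 from rfl) = 0
      rw [← Abelian.Ext.mk₀_comp_mk₀, hS.extClass_comp_assoc]

theorem ext_shift [Module.Projective R F]
    (f : K →ₗ[R] F) (g : F →ₗ[R] M) (h : Function.Exact f g)
    (hf : Function.Injective f) (hg : Function.Surjective g) (i : ℕ) :
    Nonempty (EX R K N (i+1) ≃ₗ[k] EX R M N (i+2)) := by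
  have hS := mkSC_shortExact f g h hf hg
  have hF := ext_proj_subsingleton (R := R) (F := F) (N := N) i
  have hF' := ext_proj_subsingleton (R := R) (F := F) (N := N) (i+1)
  let δ0 := hS.extClass.precompOfLinear k (ModuleCat.of R N) (show 1 + (i+1) = i+2 by omega)
  refine ⟨LinearEquiv.ofBijective δ0 ⟨?_, ?_⟩⟩
  · rw [injective_iff_map_eq_zero]
    intro x hx
    obtain ⟨y, hy⟩ := Abelian.Ext.contravariant_sequence_exact₁ hS (ModuleCat.of R N) x
        (show 1 + (i+1) = i+2 by omega) hx
    rw [← hy, Subsingleton.elim (α := EX R F N (i+1)) y 0, Abelian.Ext.comp_zero]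
  · intro x
    obtain ⟨y, hy⟩ := Abelian.Ext.contravariant_sequence_exact₃ hS (ModuleCat.of R N) x
        (Subsingleton.elim (α := EX R F N (i+1+1)) _ _) (show 1 + (i+1) = i+2 by omega)
    exact ⟨y, hy⟩

/-- Vanishing and additivity along a short exact sequence. -/
theorem ext_add (f : K →ₗ[R] F) (g : F →ₗ[R] M) (h : Function.Exact f g)
    (hf : Function.Injective f) (hg : Function.Surjective g) (d : ℕ)
    (hK : ∀ i, i ≠ d → Subsingleton (EX R K N i))
    (hM : ∀ i, i ≠ d → Subsingleton (EX R M N i))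
    (hKf : Module.Finite k (EX R K N d)) (hMf : Module.Finite k (EX R M N d)) :
    (∀ i, i ≠ d → Subsingleton (EX R F N i)) ∧ Module.Finite k (EX R F N d) ∧
      Module.finrank k (EX R F N d) =
        Module.finrank k (EX R K N d) + Module.finrank k (EX R M N d) := by
  have hS := mkSC_shortExact f g h hf hg
  refine ⟨?_, ?_⟩
  · intro i hi
    have h1 := hK i hi
    have h2 := hM i hi
    refine subsingleton_of_forall_eq 0 fun x => ?_
    obtain ⟨y, hy⟩ := Abelian.Ext.contravariant_sequence_exact₂ hS (ModuleCat.of R N) x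
      (Subsingleton.elim (α := EX R K N i) _ _)
    rw [← hy, Subsingleton.elim (α := EX R M N i) y 0, Abelian.Ext.comp_zero]
  · let a : EX R M N d →ₗ[k] EX R F N d :=
      (Abelian.Ext.mk₀ (mkSC f g h).g).precompOfLinear k (ModuleCat.of R N) (zero_add d)
    let b : EX R F N d →ₗ[k] EX R K N d :=
      (Abelian.Ext.mk₀ (mkSC f g h).f).precompOfLinear k (ModuleCat.of R N) (zero_add d)
    have ha : Function.Injective a := by
      rw [injective_iff_map_eq_zero]
      intro x hx
      cases d with
      | zero =>
        have := hS.epi_g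
        exact (injective_iff_map_eq_zero _).1 (Abelian.Ext.precomp_mk₀_injective_of_epi
          (ModuleCat.of R N) (mkSC f g h).g) x hx
      | succ d =>
        have h1 := hK d (by omega)
        obtain ⟨y, hy⟩ := Abelian.Ext.contravariant_sequence_exact₃ hS (ModuleCat.of R N) x hx
          (show 1 + d = d + 1 by omega)
        rw [← hy, Subsingleton.elim (α := EX R K N d) y 0, Abelian.Ext.comp_zero]
    have hb : Function.Surjective b := by
      intro x
      have h1 := hM (d+1) (by omega)
      obtain ⟨y, hy⟩ := Abelian.Ext.contravariant_sequence_exact₁ hS (ModuleCat.of R N) x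
        (show 1 + d = d + 1 by omega) (Subsingleton.elim (α := EX R M N (d+1)) _ _)
      exact ⟨y, hy⟩
    have hab : Function.Exact a b := by
      intro x
      constructor
      · intro hx
        obtain ⟨y, hy⟩ := Abelian.Ext.contravariant_sequence_exact₂ hS (ModuleCat.of R N) x hx
        exact ⟨y, hy⟩
      · rintro ⟨y, rfl⟩
        change (Abelian.Ext.mk₀ (mkSC f g h).f).comp ((Abelian.Ext.mk₀ (mkSC f g h).g).comp y (zero_add d)) (zero_add d) = 0
        rw [Abelian.Ext.mk₀_comp_mk₀_assoc, (mkSC f g h).zero, Abelian.Ext.mk₀_zero,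
          Abelian.Ext.zero_comp]
    have h1 : Module.Finite k (LinearMap.ker b) := by
      rw [hab.linearMap_ker_eq]; infer_instance
    have h2 : Module.Finite k (EX R F N d ⧸ LinearMap.ker b) :=
      Module.Finite.equiv (b.quotKerEquivOfSurjective hb).symm
    have hfin : Module.Finite k (EX R F N d) := Module.Finite.of_submodule_quotient
        (LinearMap.ker b)
    refine ⟨hfin, ?_⟩
    have := LinearMap.finrank_range_add_finrank_ker b
    rw [LinearMap.range_eq_top.2 hb, finrank_top, hab.linearMap_ker_eq,
        LinearMap.finrank_range_of_inj ha] at this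
    exact this.symm

/-- Retracts in the second variable. -/
theorem ext_retract {N' : Type} [AddCommGroup N'] [Module R N'] (s : N' →ₗ[R] N)
    (r : N →ₗ[R] N') (hrs : r ∘ₗ s = LinearMap.id) (i : ℕ) :
    ∃ p : EX R M N i →ₗ[k] EX R M N' i, Function.Surjective p := by
  refine ⟨(Abelian.Ext.mk₀ (ModuleCat.ofHom r)).postcompOfLinear k _ (add_zero i), ?_⟩
  intro x
  refine ⟨x.comp (Abelian.Ext.mk₀ (ModuleCat.ofHom s)) (add_zero i), ?_⟩
  change (x.comp (Abelian.Ext.mk₀ (ModuleCat.ofHom s)) (add_zero i)).comp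
    (Abelian.Ext.mk₀ (ModuleCat.ofHom r)) (add_zero i) = x
  have : ModuleCat.ofHom s ≫ ModuleCat.ofHom r = 𝟙 _ := by
    ext x; exact LinearMap.congr_fun hrs x
  rw [Abelian.Ext.comp_assoc_of_third_deg_zero, Abelian.Ext.mk₀_comp_mk₀, this,
    Abelian.Ext.comp_mk₀_id]

theorem projective_of_ext (hM : ∀ (N : Type) [AddCommGroup N] [Module R N],
    Subsingleton (EX R M N 1)) : Module.Projective R M := by
  refine Module.Projective.of_lifting_property'' (R := R) (P := M) fun p hp => ?_
  have hS := mkSC_shortExact (R := R) (K := LinearMap.ker p) (F := M →₀ R) (M := M) (LinearMap.ker p).subtype p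
    (LinearMap.exact_subtype_ker_map _) (Submodule.subtype_injective _) hp
  have h1 := hM (LinearMap.ker p)
  obtain ⟨y, hy⟩ := Abelian.Ext.covariant_sequence_exact₃ (ModuleCat.of R M) hS
    (Abelian.Ext.mk₀ (𝟙 (ModuleCat.of R M))) (show 0 + 1 = 1 from rfl)
    (Subsingleton.elim (α := EX R M (LinearMap.ker p) 1) _ _)
  obtain ⟨φ, rfl⟩ := (Abelian.Ext.mk₀_bijective _ _).2 y
  rw [Abelian.Ext.mk₀_comp_mk₀] at hy
  have h3 := (Abelian.Ext.mk₀_bijective _ _).1 hy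
  exact ⟨φ.hom, congrArg ModuleCat.Hom.hom h3⟩

end tools


section duals
open MulOpposite
variable {B : Type} [Ring B]
variable {P Q F : Type} [AddCommGroup P] [Module Bᵐᵒᵖ P] [AddCommGroup Q] [Module Bᵐᵒᵖ Q]
  [AddCommGroup F] [Module Bᵐᵒᵖ F]

/-- The dual of a linear map of right modules. -/
def rdualMap (q : P →ₗ[Bᵐᵒᵖ] Q) : (Q →ₗ[Bᵐᵒᵖ] B) →ₗ[B] (P →ₗ[Bᵐᵒᵖ] B) where
  toFun f := f ∘ₗ q
  map_add' _ _ := rfl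
  map_smul' _ _ := rfl

theorem exists_dual_basis [Module.Finite Bᵐᵒᵖ P] [Module.Projective Bᵐᵒᵖ P] :
    ∃ (m : ℕ) (x : Fin m → P) (f : Fin m → (P →ₗ[Bᵐᵒᵖ] B)),
      ∀ y, ∑ i, op (f i y) • x i = y := by
  obtain ⟨m, g, hg⟩ := Module.Finite.exists_fin' Bᵐᵒᵖ P
  obtain ⟨s, hs⟩ := Module.projective_lifting_property g LinearMap.id hg
  refine ⟨m, fun i => g (Pi.single i 1), fun i =>
    { toFun := fun y => unop (s y i)
      map_add' := fun a b => by simp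
      map_smul' := fun c a => by simp }, fun y => ?_⟩
  have h1 : g (s y) = y := LinearMap.congr_fun hs y
  conv_rhs => rw [← h1, LinearMap.pi_apply_eq_sum_univ g (s y)]
  simp only [LinearMap.coe_mk, AddHom.coe_mk, op_unop]
  refine Finset.sum_congr rfl fun i _ => ?_
  congr 2
  ext j
  simp [Pi.single_apply, eq_comm]

theorem dual_apply_sum {m : ℕ} {x : Fin m → P} {f : Fin m → (P →ₗ[Bᵐᵒᵖ] B)}
    (h : ∀ y, ∑ i, op (f i y) • x i = y) (g : P →ₗ[Bᵐᵒᵖ] B) :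
    ∑ i, g (x i) • f i = g := by
  ext y
  conv_rhs => rw [← h y, map_sum]
  simp

instance rdual_projective [Module.Finite Bᵐᵒᵖ P] [Module.Projective Bᵐᵒᵖ P] :
    Module.Projective B (P →ₗ[Bᵐᵒᵖ] B) := by
  obtain ⟨m, x, f, h⟩ := exists_dual_basis (B := B) (P := P)
  refine Module.Projective.of_split (M := Fin m → B)
    { toFun := fun g i => g (x i), map_add' := fun _ _ => rfl, map_smul' := fun _ _ => rfl }
    (Fintype.linearCombination B f) ?_
  ext1 g
  simpa [Fintype.linearCombination_apply] using dual_apply_sum h g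

theorem mem_idemLeft {u : B} (hu : u * u = u) {x : B} : x ∈ idemLeft B u ↔ x * u = x := by
  rw [idemLeft, Submodule.mem_span_singleton]
  constructor
  · rintro ⟨a, rfl⟩; simp [mul_assoc, hu]
  · intro h; exact ⟨x, h⟩

variable {k : Type} [Field k] [Algebra k B]
  [Module k P] [IsScalarTower k Bᵐᵒᵖ P] [Module k Q] [IsScalarTower k Bᵐᵒᵖ Q]
  [Module k F] [IsScalarTower k Bᵐᵒᵖ F]

/-- The subspace of a right module fixed by an element (i.e. `Pu` for idempotent `u`). -/
def fixSub (k : Type) [Field k] [Algebra k B] (P : Type) [AddCommGroup P] [Module Bᵐᵒᵖ P]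
    [Module k P] [IsScalarTower k Bᵐᵒᵖ P] (u : B) : Submodule k P where
  carrier := {x | op u • x = x}
  add_mem' {a b} ha hb := by
    simp only [Set.mem_ofPred_eq] at *
    rw [smul_add, ha, hb]
  zero_mem' := by simp
  smul_mem' c x hx := by
    simp only [Set.mem_ofPred_eq] at *
    rw [smul_comm, hx]

theorem mem_fixSub {u : B} {x : P} : x ∈ fixSub k P u ↔ op u • x = x := Iff.rfl

/-- Evaluation. -/
def evMap (k : Type) [Field k] [Algebra k B] (P : Type) [AddCommGroup P] [Module Bᵐᵒᵖ P]
    [Module k P] [IsScalarTower k Bᵐᵒᵖ P] {u : B} (hu : u * u = u) :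
    fixSub k P u →ₗ[k] ((P →ₗ[Bᵐᵒᵖ] B) →ₗ[B] idemLeft B u) where
  toFun x :=
    { toFun := fun f => ⟨f x.1, by
        rw [mem_idemLeft hu]
        have h1 : op u • x.1 = x.1 := x.2
        conv_rhs => rw [← h1, map_smul]
        simp⟩
      map_add' := fun _ _ => rfl
      map_smul' := fun _ _ => rfl }
  map_add' x y := by
    ext f; simp
  map_smul' c x := by
    ext f
    simp only [Submodule.coe_smul, RingHom.id_apply, LinearMap.coe_mk, AddHom.coe_mk,
      LinearMap.smul_apply]
    exact LinearMap.map_smul_of_tower f c x.1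

theorem evMap_apply {u : B} (hu : u * u = u) (x : fixSub k P u) (f : P →ₗ[Bᵐᵒᵖ] B) :
    (evMap k P hu x f : B) = f x.1 := rfl

theorem dual_sep [Module.Finite Bᵐᵒᵖ P] [Module.Projective Bᵐᵒᵖ P] {x y : P}
    (h : ∀ f : P →ₗ[Bᵐᵒᵖ] B, f x = f y) : x = y := by
  obtain ⟨m, z, f, hb⟩ := exists_dual_basis (B := B) (P := P)
  rw [← hb x, ← hb y]
  simp [h]

theorem evMap_bijective [Module.Finite Bᵐᵒᵖ P] [Module.Projective Bᵐᵒᵖ P]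
    {u : B} (hu : u * u = u) : Function.Bijective (evMap k P hu) := by
  constructor
  · intro x y hxy
    apply Subtype.ext
    refine dual_sep (B := B) fun f => ?_
    rw [← evMap_apply hu, ← evMap_apply hu, hxy]
  · intro φ
    obtain ⟨m, z, f, hb⟩ := exists_dual_basis (B := B) (P := P)
    refine ⟨⟨∑ i, op (φ (f i) : B) • z i, ?_⟩, ?_⟩
    · rw [mem_fixSub, Finset.smul_sum]
      refine Finset.sum_congr rfl fun i _ => ?_
      rw [smul_smul, ← op_mul, (mem_idemLeft hu).1 (φ (f i)).2]
    · ext g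
      rw [evMap_apply]
      conv_rhs => rw [← dual_apply_sum hb g]
      simp

theorem ev_extends_iff {P : Type} [AddCommGroup P] [Module Bᵐᵒᵖ P]
    [Module.Finite Bᵐᵒᵖ P] [Module.Projective Bᵐᵒᵖ P]
    [Module.Finite Bᵐᵒᵖ F] [Module.Projective Bᵐᵒᵖ F]
    {u : B} (hu : u * u = u) (q : P →ₗ[Bᵐᵒᵖ] F) (x : fixSub k F u) :
    (∃ ψ : (P →ₗ[Bᵐᵒᵖ] B) →ₗ[B] idemLeft B u, ψ ∘ₗ rdualMap q = evMap k F hu x) ↔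
      x.1 ∈ LinearMap.range q := by
  letI : Module k P := Module.restrictScalars k Bᵐᵒᵖ P
  haveI : IsScalarTower k Bᵐᵒᵖ P := IsScalarTower.restrictScalars k Bᵐᵒᵖ P
  constructor
  · rintro ⟨ψ, hψ⟩
    obtain ⟨y, rfl⟩ := (evMap_bijective (k := k) (P := P) hu).2 ψ
    refine ⟨y.1, dual_sep (B := B) fun f => ?_⟩
    have := congrArg Subtype.val (LinearMap.congr_fun hψ f)
    exact this
  · rintro ⟨y, hy⟩
    refine ⟨evMap k P hu ⟨op u • y, ?_⟩, ?_⟩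
    · rw [mem_fixSub, smul_smul, ← op_mul, hu]
    · ext f
      have h1 : op u • x.1 = x.1 := x.2
      change f (q (op u • y)) = f x.1
      rw [map_smul, hy, h1]

end duals


section ders
open MulOpposite
variable {B : Type} [Ring B]

/-- Right derivations along `δ`. -/
def RDer (δ : B →+ B) {M : Type} [AddCommGroup M] [Module Bᵐᵒᵖ M] (E : M →+ M) : Prop :=
  ∀ (b : B) (x : M), E (op b • x) = op b • E x + op (δ b) • x

/-- Left derivations along `δ`. -/
def LDer (δ : B →+ B) {M : Type} [AddCommGroup M] [Module B M] (E : M →+ M) : Prop :=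
  ∀ (b : B) (x : M), E (b • x) = δ b • x + b • E x

variable (δ : B →+ B)

theorem der_cover (hδ : ∀ a b, δ (a * b) = δ a * b + a * δ b) {M : Type} [AddCommGroup M] [Module Bᵐᵒᵖ M] [Module.Finite Bᵐᵒᵖ M]
    (EM : M →+ M) (hE : RDer δ EM) :
    ∃ (m : ℕ) (g : (Fin m → Bᵐᵒᵖ) →ₗ[Bᵐᵒᵖ] M) (E : (Fin m → Bᵐᵒᵖ) →+ (Fin m → Bᵐᵒᵖ)),
      Function.Surjective g ∧ RDer δ E ∧ ∀ x, g (E x) = EM (g x) := by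
  obtain ⟨m, g, hg⟩ := Module.Finite.exists_fin' Bᵐᵒᵖ M
  choose y hy using fun i : Fin m => hg (EM (g (Pi.single i 1)))
  refine ⟨m, g,
    { toFun := fun x => ∑ i, x i • y i + fun i => op (δ (unop (x i)))
      map_zero' := by
        ext i
        simp
      map_add' := fun a b => by
        ext i
        simp [add_smul, Finset.sum_add_distrib, add_mul]
        abel }, hg, ?_, ?_⟩
  · intro b x
    ext i
    simp [hδ, Finset.smul_sum, mul_assoc, Finset.mul_sum]
    abel
  · intro x
    have h1 : ∀ i, g (Pi.single i (op (δ (unop (x i))))) =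
        op (δ (unop (x i))) • g (Pi.single i 1) := by
      intro i
      rw [← map_smul]
      congr 1
      rw [← Pi.single_smul', smul_eq_mul, mul_one]
    have h2 : ∀ i, g (Pi.single i (x i)) = x i • g (Pi.single i 1) := by
      intro i
      rw [← map_smul]
      congr 1
      rw [← Pi.single_smul', smul_eq_mul, mul_one]
    change g (∑ i, x i • y i + fun i => op (δ (unop (x i)))) = _
    conv_rhs => rw [← Finset.univ_sum_single x]
    rw [← Finset.univ_sum_single (fun i => op (δ (unop (x i))))]
    simp only [map_add, map_sum, h1, h2, map_smul, hy]
    rw [← Finset.sum_add_distrib]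
    refine Finset.sum_congr rfl fun i _ => ?_
    exact (hE (unop (x i)) (g (Pi.single i 1))).symm

/-- The dual of a derivation. -/
theorem der_dual (hδ : ∀ a b, δ (a * b) = δ a * b + a * δ b) {M : Type} [AddCommGroup M] [Module Bᵐᵒᵖ M]
    (EM : M →+ M) (hE : RDer δ EM) :
    ∃ E : (M →ₗ[Bᵐᵒᵖ] B) →+ (M →ₗ[Bᵐᵒᵖ] B), LDer δ E ∧ ∀ f x, E f x = δ (f x) - f (EM x) := by
  refine ⟨{ toFun := fun f =>
              { toFun := fun x => δ (f x) - f (EM x)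
                map_add' := fun x y => by simp; abel
                map_smul' := fun c x => by
                  have := hE (unop c) x
                  rw [op_unop] at this
                  rw [this]
                  simp [hδ, sub_mul] }
            map_zero' := by ext; simp
            map_add' := fun f g => by ext; simp; abel }, ?_, fun _ _ => rfl⟩
  intro b f
  ext x
  change δ (b * f x) - b * f (EM x) = δ b * f x + b * (δ (f x) - f (EM x))
  rw [hδ, mul_sub]; abel

/-- Derivations descend to quotients. -/
theorem der_quot {M : Type} [AddCommGroup M] [Module B M]
    (EM : M →+ M) (hE : LDer δ EM) (L : Submodule B M) (hL : ∀ x ∈ L, EM x ∈ L) :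
    ∃ E : (M ⧸ L) →+ (M ⧸ L), LDer δ E ∧ ∀ x, E (L.mkQ x) = L.mkQ (EM x) := by
  refine ⟨QuotientAddGroup.map L.toAddSubgroup L.toAddSubgroup EM hL, ?_, fun _ => rfl⟩
  intro b x
  obtain ⟨x, rfl⟩ := L.mkQ_surjective x
  change L.mkQ (EM (b • x)) = δ b • L.mkQ x + b • L.mkQ (EM x)
  rw [hE]; simp

end ders


section syz
open MulOpposite
variable (k : Type) [Field k] {B : Type} [Ring B] [Algebra k B]

/-- Data of the `(r+1)`-st syzygy. -/
def Syz (δ : B →+ B) (S : Type) [AddCommGroup S] [Module Bᵐᵒᵖ S] [Module k S]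
    [IsScalarTower k Bᵐᵒᵖ S] (r : ℕ) : Prop :=
  ∃ (m : ℕ) (K : Submodule Bᵐᵒᵖ (Fin m → Bᵐᵒᵖ)) (E : (Fin m → Bᵐᵒᵖ) →+ (Fin m → Bᵐᵒᵖ)),
    RDer δ E ∧ (∀ x ∈ K, E x ∈ K) ∧
    (∀ (i : ℕ) (N : Type) [AddCommGroup N] [Module Bᵐᵒᵖ N],
      Nonempty (EX Bᵐᵒᵖ K N (i+1) ≃ₗ[k] EX Bᵐᵒᵖ S N (i+2+r))) ∧
    (∃ D : (K →ₗ[Bᵐᵒᵖ] B) →ₗ[k] EX Bᵐᵒᵖ S B (r+1), Function.Surjective D ∧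
      ∀ φ, D φ = 0 ↔ ∃ ψ : (Fin m → Bᵐᵒᵖ) →ₗ[Bᵐᵒᵖ] B, ψ ∘ₗ K.subtype = φ) ∧
    (∀ (P : Type) [AddCommGroup P] [Module Bᵐᵒᵖ P] [Module.Finite Bᵐᵒᵖ P]
      [Module.Projective Bᵐᵒᵖ P] (q : P →ₗ[Bᵐᵒᵖ] (Fin m → Bᵐᵒᵖ)), LinearMap.range q = K →
      ∀ u : B, u * u = u →
        Nonempty (EX B ((P →ₗ[Bᵐᵒᵖ] B) ⧸ LinearMap.range (rdualMap q)) (idemLeft B u) (r+1)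
          ≃ₗ[k] fixSub k S u))

variable (δ : B →+ B)
  (S : Type) [AddCommGroup S] [Module Bᵐᵒᵖ S] [Module k S] [IsScalarTower k Bᵐᵒᵖ S]

theorem syz_zero (hδ : ∀ a b, δ (a * b) = δ a * b + a * δ b) [Module.Finite Bᵐᵒᵖ S] (ES : S →+ S) (hE : RDer δ ES)
    (hv : Subsingleton (EX Bᵐᵒᵖ S B 0)) : Syz k δ S 0 := by
  obtain ⟨m, g, E, hg, hEd, hgE⟩ := der_cover δ hδ ES hE
  refine ⟨m, LinearMap.ker g, E, hEd, ?_, ?_, ?_, ?_⟩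
  · intro x hx
    rw [LinearMap.mem_ker] at *
    rw [hgE, hx, map_zero]
  · intro i N _ _
    exact ext_shift (LinearMap.ker g).subtype g (LinearMap.exact_subtype_ker_map g)
      (Submodule.subtype_injective _) hg i
  · exact ext_one (LinearMap.ker g).subtype g (LinearMap.exact_subtype_ker_map g)
      (Submodule.subtype_injective _) hg
  · intro P _ _ _ _ q hq u hu
    obtain ⟨eq0⟩ := ext_zero_equiv (k := k) (R := Bᵐᵒᵖ) (M := S) (N := B)
    have hS0 : Subsingleton (S →ₗ[Bᵐᵒᵖ] B) := eq0.toEquiv.subsingleton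
    have hinj : Function.Injective (rdualMap q) := by
      rw [injective_iff_map_eq_zero]
      intro f hf
      have hker : LinearMap.ker g ≤ LinearMap.ker f := by
        rw [← hq]
        rintro _ ⟨p, rfl⟩
        exact LinearMap.congr_fun hf p
      refine LinearMap.ext fun x => ?_
      let f' : S →ₗ[Bᵐᵒᵖ] B := ((LinearMap.ker g).liftQ f hker) ∘ₗ
        (g.quotKerEquivOfSurjective hg).symm.toLinearMap
      have : f' (g x) = f x := by
        have h3 : (g.quotKerEquivOfSurjective hg).symm (g x) = (LinearMap.ker g).mkQ x := by
          rw [LinearEquiv.symm_apply_eq]; rfl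
        simp only [f', LinearMap.comp_apply, LinearEquiv.coe_coe, h3]
        rfl
      rw [← this, Subsingleton.elim f' 0]
      rfl
    obtain ⟨D, hD, hDk⟩ := ext_one (k := k) (N := idemLeft B u) (rdualMap q)
      (LinearMap.range (rdualMap q)).mkQ
      (LinearMap.exact_map_mkQ_range _) hinj (Submodule.mkQ_surjective _)
    have hev := evMap_bijective (k := k) (P := Fin m → Bᵐᵒᵖ) hu
    let gk : fixSub k (Fin m → Bᵐᵒᵖ) u →ₗ[k] fixSub k S u :=
      (g.restrictScalars k).restrict (fun x hx => by
        rw [mem_fixSub] at *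
        change op u • g x = g x
        rw [← map_smul, hx])
    refine equiv_of_surj (D ∘ₗ evMap k (Fin m → Bᵐᵒᵖ) hu) gk (hD.comp hev.2) ?_ ?_
    · rintro ⟨s, hs⟩
      obtain ⟨x, rfl⟩ := hg s
      refine ⟨⟨op u • x, ?_⟩, ?_⟩
      · rw [mem_fixSub, smul_smul, ← op_mul, hu]
      · apply Subtype.ext
        change g (op u • x) = g x
        rw [map_smul]; exact hs
    · intro x
      rw [LinearMap.comp_apply, hDk, ev_extends_iff, hq, LinearMap.mem_ker, Subtype.ext_iff]
      rfl

theorem syz_succ (hδ : ∀ a b, δ (a * b) = δ a * b + a * δ b) [IsNoetherianRing Bᵐᵒᵖ] (r : ℕ) (h : Syz k δ S r)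
    (hv : Subsingleton (EX Bᵐᵒᵖ S B (r+1))) : Syz k δ S (r+1) := by
  obtain ⟨m, K, E, hE, hEK, h1, ⟨D, hD, hDk⟩, h2⟩ := h
  let EK : K →+ K := (E.comp K.toAddSubgroup.subtype).codRestrict K (fun x => hEK x.1 x.2)
  have hEK' : RDer δ EK := fun b x => Subtype.ext (hE b x.1)
  obtain ⟨m', g, E', hg, hEd, hgE⟩ := der_cover δ hδ EK hEK'
  have hqr : LinearMap.range (K.subtype ∘ₗ g) = K := by
    rw [LinearMap.range_comp, LinearMap.range_eq_top.2 hg, Submodule.map_top,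
      Submodule.range_subtype]
  refine ⟨m', LinearMap.ker g, E', hEd, ?_, ?_, ?_, ?_⟩
  · intro x hx
    rw [LinearMap.mem_ker] at *
    rw [hgE, hx, map_zero]
  · intro i N _ _
    obtain ⟨e1⟩ := ext_shift (k := k) (N := N) (LinearMap.ker g).subtype g
      (LinearMap.exact_subtype_ker_map g) (Submodule.subtype_injective _) hg i
    obtain ⟨e2⟩ := h1 (i+1) N
    have : i + 1 + 2 + r = i + 2 + (r + 1) := by omega
    rw [this] at e2
    exact ⟨e1.trans e2⟩
  · obtain ⟨D', hD', hDk'⟩ := ext_one (k := k) (N := B) (LinearMap.ker g).subtype g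
      (LinearMap.exact_subtype_ker_map g) (Submodule.subtype_injective _) hg
    obtain ⟨e2⟩ := h1 0 B
    have : 0 + 2 + r = r + 1 + 1 := by omega
    rw [this] at e2
    refine ⟨e2.toLinearMap ∘ₗ D', e2.surjective.comp hD', fun φ => ?_⟩
    rw [← hDk' φ]
    simp
  · intro P _ _ _ _ q hq u hu
    obtain ⟨e1⟩ := h2 (Fin m' → Bᵐᵒᵖ) (K.subtype ∘ₗ g) hqr u hu
    have hgq : ∀ p, g (q p) = 0 := fun p => by
      rw [← LinearMap.mem_ker, ← hq]; exact ⟨p, rfl⟩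
    have hle : LinearMap.range (rdualMap (B := B) (K.subtype ∘ₗ g)) ≤
        LinearMap.ker (rdualMap (B := B) q) := by
      rintro _ ⟨f, rfl⟩
      ext p
      change f (g (q p)) = 0
      rw [hgq]; simp
    have hge : LinearMap.ker (rdualMap (B := B) q) ≤
        LinearMap.range (rdualMap (B := B) (K.subtype ∘ₗ g)) := by
      intro f hf
      have hker : LinearMap.ker g ≤ LinearMap.ker f := by
        rw [← hq]
        rintro _ ⟨p, rfl⟩
        exact LinearMap.congr_fun hf p
      let f' : K →ₗ[Bᵐᵒᵖ] B := ((LinearMap.ker g).liftQ f hker) ∘ₗ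
        (g.quotKerEquivOfSurjective hg).symm.toLinearMap
      have hf' : ∀ x, f' (g x) = f x := by
        intro x
        have h3 : (g.quotKerEquivOfSurjective hg).symm (g x) = (LinearMap.ker g).mkQ x := by
          rw [LinearEquiv.symm_apply_eq]; rfl
        simp only [f', LinearMap.comp_apply, LinearEquiv.coe_coe, h3]
        rfl
      obtain ⟨ψ, hψ⟩ := (hDk f').1 (Subsingleton.elim _ _)
      refine ⟨ψ, ?_⟩
      refine LinearMap.ext fun x => ?_
      rw [← hf', ← hψ]
      rfl
    let j := (LinearMap.range (rdualMap (B := B) (K.subtype ∘ₗ g))).liftQ (rdualMap q) hle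
    have hj : Function.Injective j := by
      rw [← LinearMap.ker_eq_bot]
      exact Submodule.ker_liftQ_eq_bot _ _ _ hge
    have hjr : LinearMap.range j = LinearMap.range (rdualMap (B := B) q) :=
      Submodule.range_liftQ _ _ _
    have hex : Function.Exact j (LinearMap.range (rdualMap (B := B) q)).mkQ := by
      rw [LinearMap.exact_iff, Submodule.ker_mkQ, hjr]
    obtain ⟨e2⟩ := ext_shift (k := k) (N := idemLeft B u) j
      (LinearMap.range (rdualMap (B := B) q)).mkQ hex hj (Submodule.mkQ_surjective _) r
    exact ⟨e2.symm.trans e1⟩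

theorem dual_main (hδ : ∀ a b, δ (a * b) = δ a * b + a * δ b) [IsNoetherianRing Bᵐᵒᵖ] [Module.Finite Bᵐᵒᵖ S] (ES : S →+ S) (hE : RDer δ ES)
    (d : ℕ) (hvan : ∀ i, i ≠ d → Subsingleton (EX Bᵐᵒᵖ S B i))
    (hpd : ∀ (N : Type) [AddCommGroup N] [Module Bᵐᵒᵖ N] (i : ℕ), d < i →
      Subsingleton (EX Bᵐᵒᵖ S N i)) :
    ∃ (T : Type) (_ : AddCommGroup T) (_ : Module B T) (_ : Module k T)
      (_ : IsScalarTower k B T) (ET : T →+ T), LDer δ ET ∧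
      Nonempty (T ≃ₗ[k] EX Bᵐᵒᵖ S B d) ∧
      ∀ u : B, u * u = u → Nonempty (EX B T (idemLeft B u) d ≃ₗ[k] fixSub k S u) := by
  rcases Nat.eq_zero_or_pos d with rfl | hd
  · have hproj : Module.Projective Bᵐᵒᵖ S := projective_of_ext fun N _ _ => hpd N 1 one_pos
    obtain ⟨ET, hET, -⟩ := der_dual δ hδ ES hE
    refine ⟨S →ₗ[Bᵐᵒᵖ] B, inferInstance, inferInstance, inferInstance, inferInstance, ET, hET,
      ext_zero_equiv, fun u hu => ?_⟩
    obtain ⟨e0⟩ := ext_zero_equiv (k := k) (R := B) (M := S →ₗ[Bᵐᵒᵖ] B) (N := idemLeft B u)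
    exact ⟨(e0.symm).trans (LinearEquiv.ofBijective _ (evMap_bijective (k := k) hu)).symm⟩
  · have key : ∀ r, r < d → Syz k δ S r := by
      intro r
      induction r with
      | zero => exact fun _ => syz_zero k δ S hδ ES hE (hvan 0 (by omega))
      | succ r ih => exact fun hr => syz_succ k δ S hδ r (ih (by omega)) (hvan _ (by omega))
    obtain ⟨d, rfl⟩ : ∃ d', d = d' + 1 := ⟨d - 1, by omega⟩
    obtain ⟨m, K, E, hEd, hEK, h1, ⟨D, hD, hDk⟩, h2⟩ := key d (by omega)
    have hproj : Module.Projective Bᵐᵒᵖ K := projective_of_ext fun N _ _ => by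
      obtain ⟨e1⟩ := h1 0 N
      have := hpd N (0 + 2 + d) (by omega)
      exact e1.toEquiv.subsingleton
    let EK : K →+ K := (E.comp K.toAddSubgroup.subtype).codRestrict K (fun x => hEK x.1 x.2)
    have hEK' : RDer δ EK := fun b x => Subtype.ext (hEd b x.1)
    obtain ⟨E1, hE1, hE1f⟩ := der_dual δ hδ EK hEK'
    obtain ⟨E2, hE2, hE2f⟩ := der_dual δ hδ E hEd
    obtain ⟨ET, hET, -⟩ := der_quot δ E1 hE1 (LinearMap.range (rdualMap (B := B) K.subtype)) (by
      rintro _ ⟨f, rfl⟩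
      refine ⟨E2 f, ?_⟩
      ext x
      rw [hE1f]
      exact hE2f f x.1)
    refine ⟨(K →ₗ[Bᵐᵒᵖ] B) ⧸ LinearMap.range (rdualMap (B := B) K.subtype), inferInstance,
      inferInstance, inferInstance, inferInstance, ET, hET, ?_, fun u hu =>
      h2 K K.subtype (Submodule.range_subtype K) u hu⟩
    have hk : ∀ φ, ((LinearMap.range (rdualMap (B := B) K.subtype)).mkQ.restrictScalars k) φ = 0 ↔
        D φ = 0 := by
      intro φ
      rw [hDk, LinearMap.restrictScalars_apply, Submodule.mkQ_apply,
        Submodule.Quotient.mk_eq_zero]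
      exact Iff.rfl
    have hs : Function.Surjective
        ((LinearMap.range (rdualMap (B := B) K.subtype)).mkQ.restrictScalars k) := by
      rw [LinearMap.coe_restrictScalars]
      exact Submodule.mkQ_surjective _
    exact equiv_of_surj _ D hs hD hk

end syz


section graded
open MulOpposite
variable {k : Type} [Field k] {B : Type} [Ring B] [Algebra k B]
  {𝒜 : ℕ → Submodule k B} [GradedAlgebra 𝒜]

theorem exists_euler (𝒜 : ℕ → Submodule k B) [GradedAlgebra 𝒜] :
    ∃ δ : B →+ B, (∀ a b, δ (a * b) = δ a * b + a * δ b) ∧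
    ∀ m, ∀ b ∈ 𝒜 m, δ b = (m : k) • b := by
  let δ : B →+ B := (DirectSum.toAddMonoid (fun m : ℕ =>
    ((m : k) • (𝒜 m).subtype).toAddMonoidHom)).comp
      (DirectSum.decomposeAddEquiv 𝒜).toAddMonoidHom
  have h : ∀ m, ∀ b ∈ 𝒜 m, δ b = (m : k) • b := by
    intro m b hb
    change DirectSum.toAddMonoid _ (DirectSum.decompose 𝒜 b) = _
    rw [DirectSum.decompose_of_mem 𝒜 hb, DirectSum.toAddMonoid_of]
    rfl
  refine ⟨δ, ?_, h⟩
  intro a b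
  induction a using DirectSum.Decomposition.inductionOn 𝒜 with
  | zero => simp
  | add x y hx hy => rw [add_mul, map_add, hx, hy, map_add]; noncomm_ring
  | @homogeneous i x =>
    induction b using DirectSum.Decomposition.inductionOn 𝒜 with
    | zero => simp
    | add x y hx hy => rw [mul_add, map_add, hx, hy, map_add]; noncomm_ring
    | @homogeneous j y =>
      rw [h _ _ x.2, h _ _ y.2, h (i + j) _ (SetLike.mul_mem_graded x.2 y.2)]
      push_cast
      rw [add_smul, smul_mul_assoc, mul_smul_comm]

/-- An additive predicate that holds in positive degree holds for `b - b₀`. -/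
theorem pos_induction (p : B → Prop) (h0 : p 0) (hadd : ∀ a b, p a → p b → p (a + b))
    (hp : ∀ m, 1 ≤ m → ∀ b ∈ 𝒜 m, p b) (b : B) :
    p (b - GradedRing.projZeroRingHom 𝒜 b) := by
  induction b using DirectSum.Decomposition.inductionOn 𝒜 with
  | zero => simpa using h0
  | add x y hx hy =>
    rw [map_add, add_sub_add_comm]
    exact hadd _ _ hx hy
  | @homogeneous i x =>
    rw [GradedRing.projZeroRingHom_apply]
    rcases Nat.eq_zero_or_pos i with rfl | hi
    · rw [DirectSum.decompose_of_mem_same 𝒜 x.2, sub_self]; exact h0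
    · rw [DirectSum.decompose_of_mem_ne 𝒜 x.2 (by omega), sub_zero]
      exact hp i hi _ x.2

theorem proj_pos {m : ℕ} (hm : 1 ≤ m) {b : B} (hb : b ∈ 𝒜 m) :
    GradedRing.projZeroRingHom 𝒜 b = 0 := by
  rw [GradedRing.projZeroRingHom_apply, DirectSum.decompose_of_mem_ne 𝒜 hb (by omega)]

variable {n : ℕ} {e : Fin n → B}

theorem proj_zero_e (hset : GradedKnAlgebra k B 𝒜 e) (i : Fin n) : GradedRing.projZeroRingHom 𝒜 (e i) = e i := by
  rw [GradedRing.projZeroRingHom_apply, DirectSum.decompose_of_mem_same 𝒜 (hset.mem_deg_zero i)]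

theorem exists_coeff (hset : GradedKnAlgebra k B 𝒜 e) (b : B) : ∃ c : Fin n → k,
    GradedRing.projZeroRingHom 𝒜 b = ∑ i, c i • e i := by
  have : GradedRing.projZeroRingHom 𝒜 b ∈ 𝒜 0 := by
    rw [GradedRing.projZeroRingHom_apply]; exact SetLike.coe_mem _
  rw [hset.deg_zero_eq, Submodule.mem_span_range_iff_exists_fun] at this
  obtain ⟨c, hc⟩ := this
  exact ⟨c, hc.symm⟩

theorem left_decomp (hset : GradedKnAlgebra k B 𝒜 e) (i : Fin n) (b : B) : ∃ c : k,
    b * e i - c • e i ∈ idemLeftPos k B 𝒜 (e i) := by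
  obtain ⟨c, hc⟩ := exists_coeff hset b
  refine ⟨c i, ?_⟩
  have h1 : GradedRing.projZeroRingHom 𝒜 b * e i = c i • e i := by
    rw [hc, Finset.sum_mul]
    simp [hset.orth]
  rw [← h1, ← sub_mul]
  refine pos_induction (𝒜 := 𝒜) (fun y => y * e i ∈ idemLeftPos k B 𝒜 (e i)) ?_ ?_ ?_ b
  · simp
  · intro a b ha hb; rw [add_mul]; exact add_mem ha hb
  · intro m hm b hb
    exact Submodule.subset_span ⟨m, hm, b, hb, rfl⟩

theorem right_decomp (hset : GradedKnAlgebra k B 𝒜 e) (i : Fin n) (b : B) : ∃ c : k,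
    e i * b - c • e i ∈ idemRightPos k B 𝒜 (e i) := by
  obtain ⟨c, hc⟩ := exists_coeff hset b
  refine ⟨c i, ?_⟩
  have h1 : e i * GradedRing.projZeroRingHom 𝒜 b = c i • e i := by
    rw [hc, Finset.mul_sum]
    simp [hset.orth]
  rw [← h1, ← mul_sub]
  refine pos_induction (𝒜 := 𝒜) (fun y => e i * y ∈ idemRightPos k B 𝒜 (e i)) ?_ ?_ ?_ b
  · simp
  · intro a b ha hb; rw [mul_add]; exact add_mem ha hb
  · intro m hm b hb
    exact Submodule.subset_span ⟨m, hm, b, hb, rfl⟩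

theorem rightPos_proj (x : B) {y : B} (hy : y ∈ idemRightPos k B 𝒜 x) :
    GradedRing.projZeroRingHom 𝒜 y = 0 := by
  induction hy using Submodule.span_induction with
  | mem y hy => obtain ⟨m, hm, z, hz, rfl⟩ := hy; rw [map_mul, proj_pos hm hz, mul_zero]
  | zero => simp
  | add a b _ _ ha hb => rw [map_add, ha, hb, add_zero]
  | smul c a _ ha =>
    have : c • a = a * unop c := rfl
    rw [this, map_mul, ha, zero_mul]

theorem e_ne_zero (hset : GradedKnAlgebra k B 𝒜 e) (i : Fin n) : e i ≠ 0 := (hset.primitive i).1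

/-- Properties of the simple right modules. -/
theorem simpleRight_facts (hset : GradedKnAlgebra k B 𝒜 e) (j : Fin n) :
    ∃ s : simpleRight k B 𝒜 (e j), s ≠ 0 ∧ (∀ x, ∃ c : k, x = c • s) ∧
      (∀ m, 1 ≤ m → ∀ b ∈ 𝒜 m, op b • s = 0) ∧
      ∀ l, op (e l) • s = if l = j then s else 0 := by
  have hej : e j ∈ idemRight B (e j) := Submodule.subset_span rfl
  refine ⟨Submodule.Quotient.mk ⟨e j, hej⟩, ?_, ?_, ?_, ?_⟩
  · intro h
    rw [Submodule.Quotient.mk_eq_zero, Submodule.mem_comap] at h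
    have := rightPos_proj (𝒜 := 𝒜) (e j) h
    exact e_ne_zero hset j ((proj_zero_e hset j).symm.trans this)
  · intro x
    obtain ⟨⟨y, hy⟩, rfl⟩ := Submodule.Quotient.mk_surjective _ x
    obtain ⟨b, rfl⟩ := Submodule.mem_span_singleton.1 hy
    obtain ⟨c, hc⟩ := right_decomp hset j (unop b)
    refine ⟨c, ?_⟩
    rw [← Submodule.Quotient.mk_smul, Submodule.Quotient.eq, Submodule.mem_comap]
    exact hc
  · intro m hm b hb
    rw [← Submodule.Quotient.mk_smul, Submodule.Quotient.mk_eq_zero, Submodule.mem_comap]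
    exact Submodule.subset_span ⟨m, hm, b, hb, rfl⟩
  · intro l
    have h1 : op (e l) • (⟨e j, hej⟩ : idemRight B (e j)) = if l = j then ⟨e j, hej⟩ else 0 := by
      apply Subtype.ext
      change e j * e l = _
      rw [hset.orth]
      by_cases h : l = j
      · subst h; simp
      · rw [if_neg h, if_neg (Ne.symm h)]; rfl
    rw [← Submodule.Quotient.mk_smul, h1]
    split_ifs <;> simp

theorem simpleRight_finite (j : Fin n) : Module.Finite Bᵐᵒᵖ (simpleRight k B 𝒜 (e j)) := by
  have : Module.Finite Bᵐᵒᵖ (idemRight B (e j)) := by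
    rw [Module.Finite.iff_fg]; exact Submodule.fg_span_singleton _
  infer_instance

theorem simpleRight_der (hset : GradedKnAlgebra k B 𝒜 e) (δ : B →+ B) (hδ : ∀ m, ∀ b ∈ 𝒜 m, δ b = (m : k) • b) (j : Fin n) :
    RDer δ (0 : simpleRight k B 𝒜 (e j) →+ simpleRight k B 𝒜 (e j)) := by
  obtain ⟨s, -, hs, hpos, -⟩ := simpleRight_facts hset j
  intro b x
  obtain ⟨c, rfl⟩ := hs x
  simp only [AddMonoidHom.zero_apply, smul_zero, zero_add]
  rw [smul_comm]
  have : op (δ b) • s = 0 := by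
    induction b using DirectSum.Decomposition.inductionOn 𝒜 with
    | zero => simp
    | add x y hx hy => rw [map_add, MulOpposite.op_add, add_smul, hx, hy, add_zero]
    | @homogeneous i x =>
      rw [hδ _ _ x.2]
      rcases Nat.eq_zero_or_pos i with rfl | hi
      · simp
      · exact hpos i hi _ ((𝒜 i).smul_mem _ x.2)
  rw [this, smul_zero]

theorem simpleRight_fix (hset : GradedKnAlgebra k B 𝒜 e) (j l : Fin n) :
    Module.finrank k (fixSub k (simpleRight k B 𝒜 (e j)) (e l)) = if j = l then 1 else 0 := by
  obtain ⟨s, hs0, hs, -, he⟩ := simpleRight_facts hset j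
  by_cases h : j = l
  · subst h
    rw [if_pos rfl]
    have : fixSub k (simpleRight k B 𝒜 (e j)) (e j) = Submodule.span k {s} := by
      ext x
      rw [Submodule.mem_span_singleton]
      constructor
      · intro _; obtain ⟨c, hc⟩ := hs x; exact ⟨c, hc.symm⟩
      · rintro ⟨c, rfl⟩
        rw [mem_fixSub, smul_comm, he, if_pos rfl]
    rw [this, finrank_span_singleton hs0]
  · rw [if_neg h]
    have : fixSub k (simpleRight k B 𝒜 (e j)) (e l) = ⊥ := by
      rw [eq_bot_iff]
      intro x hx
      rw [mem_fixSub] at hx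
      obtain ⟨c, rfl⟩ := hs x
      rw [smul_comm, he, if_neg (Ne.symm h), smul_zero] at hx
      exact hx.symm
    rw [this, finrank_bot]

end graded


section filt
variable {k : Type} [Field k] [IsAlgClosed k] [CharZero k] {B : Type} [Ring B] [Algebra k B]
  {𝒜 : ℕ → Submodule k B} [GradedAlgebra 𝒜]
variable {n : ℕ} {e : Fin n → B}

theorem ext_subsingleton_src {R : Type} [Ring R] {M N : Type} [AddCommGroup M] [Module R M]
    [AddCommGroup N] [Module R N] [Subsingleton M] (i : ℕ) : Subsingleton (EX R M N i) := by
  refine subsingleton_of_forall_eq 0 fun x => ?_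
  have h : 𝟙 (ModuleCat.of R M) = 0 := by
    ext y; exact Subsingleton.elim (α := M) _ _
  rw [← Abelian.Ext.mk₀_id_comp x, h]
  simp

/-- An eigenvalue which is maximal along its integer ladder. -/
theorem exists_top_eigenvalue {T : Type} [AddCommGroup T] [Module k T] [Module.Finite k T]
    [Nontrivial T] (f : Module.End k T) :
    ∃ μ, f.HasEigenvalue μ ∧ ∀ m : ℕ, 1 ≤ m → ¬ f.HasEigenvalue (μ + m) := by
  obtain ⟨μ₀, h₀⟩ := Module.End.exists_eigenvalue f
  let A : Set ℕ := {m | f.HasEigenvalue (μ₀ + m)}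
  have hA : A.Finite := (Module.End.finite_hasEigenvalue f).preimage
    (f := fun m : ℕ => μ₀ + (m : k)) (fun a _ b _ hab => by simpa using hab)
  have h0 : (0 : ℕ) ∈ A := by
    change f.HasEigenvalue (μ₀ + (0 : ℕ))
    simpa using h₀
  obtain ⟨M, hM, hmax⟩ := hA.exists_maximalFor id A ⟨0, h0⟩
  refine ⟨μ₀ + M, hM, fun m hm hc => ?_⟩
  have : M + m ∈ A := by
    change f.HasEigenvalue (μ₀ + ((M + m : ℕ) : k))
    rw [Nat.cast_add, ← add_assoc]; exact hc
  have := hmax this (by simp)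
  simp at this
  omega

/-- A simple submodule in a finite-dimensional module with a derivation. -/
theorem exists_simple_sub (hset : GradedKnAlgebra k B 𝒜 e) (δ : B →+ B)
    (hδ : ∀ m, ∀ b ∈ 𝒜 m, δ b = (m : k) • b)
    {T : Type} [AddCommGroup T] [Module B T] [Module k T] [IsScalarTower k B T]
    [Module.Finite k T] [Nontrivial T] (ET : T →+ T) (hE : LDer δ ET) :
    ∃ (i : Fin n) (f : simpleLeft k B 𝒜 (e i) →ₗ[B] T), Function.Injective f ∧
      (∀ x ∈ LinearMap.range f, ET x ∈ LinearMap.range f) ∧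
      Module.finrank k (T ⧸ LinearMap.range f) + 1 = Module.finrank k T := by
  let EL : Module.End k T :=
    { toFun := ET
      map_add' := map_add ET
      map_smul' := fun c x => by
        have h1 := hE (algebraMap k B c) x
        rw [hδ 0 _ (SetLike.algebraMap_mem_graded 𝒜 c)] at h1
        simpa using h1 }
  obtain ⟨μ, hμ, hμt⟩ := exists_top_eigenvalue EL
  obtain ⟨t, ht⟩ := hμ.exists_hasEigenvector
  have htE : ET t = μ • t := ht.apply_eq_smul
  have hpos : ∀ m, 1 ≤ m → ∀ b ∈ 𝒜 m, b • t = 0 := by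
    intro m hm b hb
    by_contra hne
    refine hμt m hm (Module.End.hasEigenvalue_of_hasEigenvector (x := b • t) ⟨?_, hne⟩)
    rw [Module.End.mem_genEigenspace_one]
    change ET (b • t) = _
    rw [hE, hδ m b hb, htE, add_smul, smul_assoc, smul_comm b μ t, add_comm]
  obtain ⟨i, hi⟩ : ∃ i, e i • t ≠ 0 := by
    by_contra! hc
    apply ht.2
    rw [← one_smul B t, ← hset.sum_eq_one, Finset.sum_smul]
    exact Finset.sum_eq_zero fun i _ => hc i
  set t₀ := e i • t with ht₀
  have hee : e i * e i = e i := by simpa using hset.orth i i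
  have het : e i • t₀ = t₀ := by rw [ht₀, smul_smul, hee]
  have hpos₀ : ∀ m, 1 ≤ m → ∀ b ∈ 𝒜 m, b • t₀ = 0 := by
    intro m hm b hb
    rw [ht₀, smul_smul]
    refine hpos m hm _ ?_
    simpa using SetLike.mul_mem_graded hb (hset.mem_deg_zero i)
  have hEt₀ : ET t₀ = μ • t₀ := by
    rw [ht₀, hE, hδ 0 _ (hset.mem_deg_zero i), htE, smul_comm (e i) μ t]
    simp
  have hkill : ∀ y ∈ idemLeftPos k B 𝒜 (e i), y • t₀ = 0 := by
    intro y hy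
    induction hy using Submodule.span_induction with
    | mem y hy =>
      obtain ⟨m, hm, z, hz, rfl⟩ := hy
      rw [mul_smul, het, hpos₀ m hm z hz]
    | zero => simp
    | add a b _ _ ha hb => rw [add_smul, ha, hb, add_zero]
    | smul c a _ ha => rw [smul_assoc, ha, smul_zero]
  have hc : ∀ b : B, ∃ c : k, b * e i - c • e i ∈ idemLeftPos k B 𝒜 (e i) ∧ b • t₀ = c • t₀ := by
    intro b
    obtain ⟨c, hc⟩ := left_decomp hset i b
    refine ⟨c, hc, ?_⟩
    have := hkill _ hc
    rwa [sub_smul, mul_smul, smul_assoc, het, sub_eq_zero] at this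
  let f₀ : idemLeft B (e i) →ₗ[B] T := (LinearMap.toSpanSingleton B T t₀) ∘ₗ (idemLeft B (e i)).subtype
  have hf₀ : ∀ y, f₀ y = (y : B) • t₀ := fun y => rfl
  have hk : LinearMap.ker f₀ =
      Submodule.comap (idemLeft B (e i)).subtype (idemLeftPos k B 𝒜 (e i)) := by
    ext ⟨y, hy⟩
    rw [LinearMap.mem_ker, hf₀, Submodule.mem_comap]
    constructor
    · intro h
      obtain ⟨b, rfl⟩ := Submodule.mem_span_singleton.1 hy
      obtain ⟨c, hc1, hc2⟩ := hc b
      change (b * e i) • t₀ = 0 at h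
      rw [mul_smul, het, hc2] at h
      have hc0 : c = 0 := (smul_eq_zero.1 h).resolve_right hi
      rw [hc0, zero_smul, sub_zero] at hc1
      exact hc1
    · exact hkill y
  let f : simpleLeft k B 𝒜 (e i) →ₗ[B] T := Submodule.liftQ _ f₀ hk.ge
  have hfr : ∀ x, x ∈ LinearMap.range f ↔ ∃ c : k, c • t₀ = x := by
    intro x
    have : LinearMap.range f = LinearMap.range f₀ := Submodule.range_liftQ _ _ _
    rw [this]
    constructor
    · rintro ⟨y, rfl⟩
      obtain ⟨c, -, h2⟩ := hc (y : B)
      exact ⟨c, h2.symm⟩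
    · rintro ⟨c, rfl⟩
      refine ⟨⟨c • e i, ?_⟩, ?_⟩
      · exact Submodule.smul_of_tower_mem _ c (Submodule.subset_span rfl)
      · rw [hf₀]
        change (c • e i) • t₀ = _
        rw [smul_assoc, het]
  refine ⟨i, f, ?_, ?_, ?_⟩
  · rw [← LinearMap.ker_eq_bot]
    exact Submodule.ker_liftQ_eq_bot _ _ _ hk.le
  · intro x hx
    obtain ⟨c, rfl⟩ := (hfr x).1 hx
    refine (hfr _).2 ⟨c * μ, ?_⟩
    have h1 : ET (c • t₀) = c • ET t₀ := EL.map_smul c t₀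
    rw [h1, hEt₀, mul_smul]
  · have h1 := LinearMap.finrank_range_add_finrank_ker ((LinearMap.range f).mkQ.restrictScalars k)
    have h2 : LinearMap.ker ((LinearMap.range f).mkQ.restrictScalars k) = Submodule.span k {t₀} := by
      ext x
      rw [LinearMap.mem_ker, LinearMap.restrictScalars_apply, Submodule.mkQ_apply,
        Submodule.Quotient.mk_eq_zero, hfr, Submodule.mem_span_singleton]
    have h3 : LinearMap.range ((LinearMap.range f).mkQ.restrictScalars k) = ⊤ := by
      rw [LinearMap.range_eq_top, LinearMap.coe_restrictScalars]
      exact Submodule.mkQ_surjective _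
    rw [h2, h3, finrank_span_singleton hi, finrank_top] at h1
    exact h1

theorem filt (hset : GradedKnAlgebra k B 𝒜 e) (δ : B →+ B)
    (hδ : ∀ m, ∀ b ∈ 𝒜 m, δ b = (m : k) • b) (d : ℕ) (s : ℕ) :
    ∀ (T : Type) [AddCommGroup T] [Module B T] [Module k T] [IsScalarTower k B T]
    [Module.Finite k T] (ET : T →+ T), LDer δ ET → Module.finrank k T = s →
    ∃ m : Fin n → ℕ, ∑ i, m i = s ∧ ∀ (N : Type) [AddCommGroup N] [Module B N],
      (∀ i j, j ≠ d → Subsingleton (EX B (simpleLeft k B 𝒜 (e i)) N j)) →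
      (∀ i, Module.Finite k (EX B (simpleLeft k B 𝒜 (e i)) N d)) →
      (∀ j, j ≠ d → Subsingleton (EX B T N j)) ∧ Module.Finite k (EX B T N d) ∧
        Module.finrank k (EX B T N d) =
          ∑ i, m i * Module.finrank k (EX B (simpleLeft k B 𝒜 (e i)) N d) := by
  induction s with
  | zero =>
    intro T _ _ _ _ _ ET hE hT
    have : Subsingleton T := Module.finrank_zero_iff.1 hT
    refine ⟨0, by simp, fun N _ _ _ _ => ?_⟩
    have h : ∀ j, Subsingleton (EX B T N j) := fun j => ext_subsingleton_src j
    have hd := h d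
    refine ⟨fun j _ => h j, inferInstance, ?_⟩
    rw [Module.finrank_zero_of_subsingleton]; simp
  | succ s ih =>
    intro T _ _ _ _ _ ET hE hT
    have : Nontrivial T := Module.nontrivial_of_finrank_pos (R := k) (by omega)
    obtain ⟨i, f, hf, hst, hdim⟩ := exists_simple_sub hset δ hδ ET hE
    obtain ⟨E', hE', -⟩ := der_quot δ ET hE (LinearMap.range f) hst
    have hfinq : Module.Finite k (T ⧸ LinearMap.range f) :=
      Module.Finite.of_surjective ((LinearMap.range f).mkQ.restrictScalars k) (by
        rw [LinearMap.coe_restrictScalars]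
        exact Submodule.mkQ_surjective _)
    obtain ⟨m, hm, hmN⟩ := ih (T ⧸ LinearMap.range f) E' hE' (by omega)
    refine ⟨m + Pi.single i 1, ?_, fun N _ _ hv hfin => ?_⟩
    · simp [Finset.sum_add_distrib, hm]
    · obtain ⟨h1, h2, h3⟩ := hmN N hv hfin
      obtain ⟨g1, g2, g3⟩ := ext_add (k := k) (N := N) f (LinearMap.range f).mkQ
        (LinearMap.exact_map_mkQ_range f) hf (Submodule.mkQ_surjective _) d (hv i) h1 (hfin i) h2
      refine ⟨g1, g2, ?_⟩
      rw [g3, h3]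
      simp [add_mul, Finset.sum_add_distrib, Pi.single_apply, add_comm]

theorem matrix_lemma {n : ℕ} (m c : Fin n → Fin n → ℕ)
    (h : ∀ j l, ∑ i, m j i * c i l = if j = l then 1 else 0) (j : Fin n) :
    ∑ i, m j i = 1 := by
  have h1 : (Matrix.of fun i j => (m i j : ℤ)) * (Matrix.of fun i j => (c i j : ℤ)) = 1 := by
    ext j l
    rw [Matrix.mul_apply, Matrix.one_apply]
    have := h j l
    simp only [Matrix.of_apply]
    exact_mod_cast this
  have h2 := mul_eq_one_comm.1 h1
  have h3 : ∀ i l, ∑ j, c i j * m j l = if i = l then 1 else 0 := by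
    intro i l
    have := congrFun (congrFun h2 i) l
    rw [Matrix.mul_apply, Matrix.one_apply] at this
    simp only [Matrix.of_apply] at this
    exact_mod_cast this
  -- for each `i`, `c i j * m j i = 1` for exactly one `j`
  obtain ⟨i, hi⟩ : ∃ i, m j i * c i j ≠ 0 := by
    by_contra! hc
    have := h j j
    rw [Finset.sum_eq_zero (fun i _ => hc i)] at this
    simp at this
  have hcij : c i j ≠ 0 := fun h => hi (by rw [h, mul_zero])
  have hother : ∀ l, l ≠ i → m j l = 0 := by
    intro l hl
    have := h3 i l
    rw [if_neg (Ne.symm hl), Finset.sum_eq_zero_iff] at this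
    have := this j (Finset.mem_univ _)
    exact (mul_eq_zero.1 this).resolve_left hcij
  have hs := h j j
  rw [Finset.sum_eq_single i (fun l _ hl => by rw [hother l hl, zero_mul]) (by simp),
    if_pos rfl] at hs
  rw [Finset.sum_eq_single i (fun l _ hl => hother l hl) (by simp)]
  exact Nat.eq_one_of_mul_eq_one_right hs

end filt


theorem idemLeft_retract {k : Type} [Field k] {B : Type} [Ring B] [Algebra k B]
    {M : Type} [AddCommGroup M] [Module B M] {u : B} (hu : u * u = u) (i : ℕ) :
    ∃ p : EX B M B i →ₗ[k] EX B M (idemLeft B u) i, Function.Surjective p := by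
  refine ext_retract (idemLeft B u).subtype
    { toFun := fun x => ⟨x * u, (mem_idemLeft hu).2 (by rw [mul_assoc, hu])⟩
      map_add' := fun x y => Subtype.ext (add_mul x y u)
      map_smul' := fun c x => Subtype.ext (mul_assoc c x u) } ?_ i
  ext x
  exact (mem_idemLeft hu).1 x.2


variable (k : Type) [Field k] [IsAlgClosed k] [CharZero k]
variable (B : Type) [Ring B] [Algebra k B]
variable (𝒜 : ℕ → Submodule k B) [GradedAlgebra 𝒜]
variable (n : ℕ) (e : Fin n → B)

/-- Let `B` be noetherian ℕ-graded with `B₀ ≅ k^n` of finite global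
dimension `d`, with all `pdim_B(S_i)` equal and all `pdim_{B^op}(S_i^*)` equal.  If
`Ext^i_{B^op}(S_j^*, B) = 0 = Ext^i_B(S_j, B)` for `i ≠ d` and the `d`-th Ext groups are
finite-dimensional over `k`, then `dim_k Ext^d_B(S_j, B) = 1` for every `j`. -/
theorem ext_top_dimension_one
    (hset : GradedKnAlgebra k B 𝒜 e)
    (d : ℕ) (hgl : globalDim k Bᵐᵒᵖ = (d : ℕ∞))
    (hpdR : ∀ i j : Fin n,
      projDim k Bᵐᵒᵖ (simpleRightCat k B 𝒜 (e i))
        = projDim k Bᵐᵒᵖ (simpleRightCat k B 𝒜 (e j)))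
    (hpdL : ∀ i j : Fin n,
      projDim k B (simpleLeftCat k B 𝒜 (e i))
        = projDim k B (simpleLeftCat k B 𝒜 (e j)))
    (hvanR : ∀ (j : Fin n) (i : ℕ), i ≠ d →
      Subsingleton (extGroup k Bᵐᵒᵖ i (simpleRightCat k B 𝒜 (e j)) (selfRightCat B)))
    (hvanL : ∀ (j : Fin n) (i : ℕ), i ≠ d →
      Subsingleton (extGroup k B i (simpleLeftCat k B 𝒜 (e j)) (selfLeftCat B)))
    (hfinR : ∀ j : Fin n, FiniteDimensional k
      (extGroup k Bᵐᵒᵖ d (simpleRightCat k B 𝒜 (e j)) (selfRightCat B)))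
    (hfinL : ∀ j : Fin n, FiniteDimensional k
      (extGroup k B d (simpleLeftCat k B 𝒜 (e j)) (selfLeftCat B))) :
    ∀ j : Fin n,
      Module.finrank k
        (extGroup k Bᵐᵒᵖ d (simpleRightCat k B 𝒜 (e j)) (selfRightCat B)) = 1 := by
  have hnoethOp := hset.noetherian_op
  obtain ⟨δ, hδ, hδm⟩ := exists_euler 𝒜
  -- global dimension gives vanishing
  have hgl' : ∀ M : ModuleCat.{0} Bᵐᵒᵖ, projDimLE k Bᵐᵒᵖ M d := by
    have hne : {x : ℕ∞ | ∃ d : ℕ, x = (d : ℕ∞) ∧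
        ∀ M : ModuleCat.{0} Bᵐᵒᵖ, projDimLE k Bᵐᵒᵖ M d}.Nonempty := by
      by_contra hc
      rw [Set.not_nonempty_iff_eq_empty] at hc
      rw [globalDim, hc, sInf_empty] at hgl
      exact ENat.coe_ne_top d hgl.symm
    obtain ⟨d', hd', hM⟩ := csInf_mem hne
    have : (d : ℕ∞) = (d' : ℕ∞) := hgl.symm.trans hd'
    rw [Nat.cast_inj] at this
    rw [this]; exact hM
  have hidem : ∀ i, e i * e i = e i := fun i => by simpa using hset.orth i i
  -- vanishing and finiteness for the left modules `B e_l`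
  have hLvan : ∀ l i j, j ≠ d →
      Subsingleton (EX B (simpleLeft k B 𝒜 (e i)) (idemLeft B (e l)) j) := by
    intro l i j hj
    obtain ⟨e1⟩ := ext_bridge (k := k) (simpleLeftCat k B 𝒜 (e i)) (selfLeftCat B) j
    have := hvanL i j hj
    have h1 : Subsingleton (EX B (simpleLeft k B 𝒜 (e i)) B j) := e1.symm.toEquiv.subsingleton
    obtain ⟨p, hp⟩ := idemLeft_retract (k := k) (M := simpleLeft k B 𝒜 (e i)) (hidem l) j
    exact hp.subsingleton
  have hLfin : ∀ l i,
      Module.Finite k (EX B (simpleLeft k B 𝒜 (e i)) (idemLeft B (e l)) d) := by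
    intro l i
    obtain ⟨e1⟩ := ext_bridge (k := k) (simpleLeftCat k B 𝒜 (e i)) (selfLeftCat B) d
    have := hfinL i
    have h1 : Module.Finite k (EX B (simpleLeft k B 𝒜 (e i)) B d) := Module.Finite.equiv e1
    obtain ⟨p, hp⟩ := idemLeft_retract (k := k) (M := simpleLeft k B 𝒜 (e i)) (hidem l) d
    exact Module.Finite.of_surjective p hp
  have main : ∀ j, ∃ m : Fin n → ℕ,
      ∑ i, m i = Module.finrank k
        (extGroup k Bᵐᵒᵖ d (simpleRightCat k B 𝒜 (e j)) (selfRightCat B)) ∧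
      ∀ l, ∑ i, m i * Module.finrank k
        (EX B (simpleLeft k B 𝒜 (e i)) (idemLeft B (e l)) d) = if j = l then 1 else 0 := by
    intro j
    have hfS := simpleRight_finite (k := k) (𝒜 := 𝒜) (e := e) j
    obtain ⟨T, _, _, _, _, ET, hET, ⟨eT⟩, hT⟩ := dual_main k δ (simpleRight k B 𝒜 (e j)) hδ 0
      (simpleRight_der hset δ hδm j) d
      (fun i hi => by
        obtain ⟨e1⟩ := ext_bridge (k := k) (simpleRightCat k B 𝒜 (e j)) (selfRightCat B) i
        have := hvanR j i hi
        exact e1.symm.toEquiv.subsingleton)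
      (fun N _ _ i hi => by
        obtain ⟨e1⟩ := ext_bridge (k := k) (simpleRightCat k B 𝒜 (e j)) (ModuleCat.of Bᵐᵒᵖ N) i
        have := hgl' (simpleRightCat k B 𝒜 (e j)) (ModuleCat.of Bᵐᵒᵖ N) i hi
        exact e1.symm.toEquiv.subsingleton)
    obtain ⟨e1⟩ := ext_bridge (k := k) (simpleRightCat k B 𝒜 (e j)) (selfRightCat B) d
    have e2 : T ≃ₗ[k] extGroup k Bᵐᵒᵖ d (simpleRightCat k B 𝒜 (e j)) (selfRightCat B) :=
      eT.trans e1.symm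
    have := hfinR j
    have hTf : Module.Finite k T := Module.Finite.equiv e2.symm
    obtain ⟨m, hm, hmN⟩ := filt hset δ hδm d (Module.finrank k T) T ET hET rfl
    refine ⟨m, hm.trans e2.finrank_eq, fun l => ?_⟩
    obtain ⟨-, -, h3⟩ := hmN (idemLeft B (e l)) (hLvan l) (hLfin l)
    obtain ⟨e3⟩ := hT (e l) (hidem l)
    rw [← h3, e3.finrank_eq, simpleRight_fix hset]
  choose m hm1 hm2 using main
  intro j
  rw [← hm1]
  exact matrix_lemma m _ hm2 j

end
end
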